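/- arXiv:0801.1904 — 6 statements merged into one kernel-verified Lean document; each statement's English description precedes it below -/
import Mathlib

section
/- Let (X,d) be a metric space, Y a paracompact Hausdorff C-space, and f : X → Y an open continuous surjection such that each fiber f⁻¹(y) is dense in itself (has no isolated points) and d-complete. Then for every open section U for f there exist disjoint open sections U₀, U₁ for f such that the closure of Uᵢ is contained in U for i = 0, 1. -/
open Set Topology Filter

/-- A topological space `Y` is a C-space if for every sequence of open covers `W n`
there is a sequence `V n` of pairwise disjoint open families such that each `V n`
refines `W n` and the union of all `V n` is a cover. -/
def IsCSpace (Y : Type*) [TopologicalSpace Y] : Prop :=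
  ∀ W : ℕ → Set (Set Y),
    (∀ n, (∀ U ∈ W n, IsOpen U) ∧ ⋃₀ W n = Set.univ) →
    ∃ V : ℕ → Set (Set Y),
      (∀ n, (∀ U ∈ V n, IsOpen U) ∧ (V n).Pairwise Disjoint ∧
        ∀ U ∈ V n, ∃ W' ∈ W n, U ⊆ W') ∧
      ⋃₀ (⋃ n, V n) = Set.univ

/-- A subset `A ⊆ X` is C*-embedded if every bounded continuous real-valued
function on `A` extends continuously to `X`. -/
def CStarEmbedded {X : Type*} [TopologicalSpace X] (A : Set X) : Prop :=
  ∀ g : C(A, ℝ), (∃ M : ℝ, ∀ a : A, |g a| ≤ M) →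
    ∃ G : C(X, ℝ), ∀ a : A, G a = g a

/-- The restriction map from `L` to the functions on the fiber over `y` is injective. -/
def FibInj {X Y : Type*} [TopologicalSpace X] (f : X → Y) (L : Submodule ℝ C(X, ℝ)) (y : Y) :
    Prop :=
  ∀ h ∈ L, (∀ x, f x = y → h x = 0) → h = 0

theorem fibInj_eventually {X Y : Type*} [TopologicalSpace X] [TopologicalSpace Y] {f : X → Y}
    (hopen : IsOpenMap f) (L : Submodule ℝ C(X, ℝ)) [FiniteDimensional ℝ L] (y : Y)
    (h : FibInj f L y) : ∀ᶠ z in 𝓝 y, FibInj f L z := by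
  let b := Module.finBasis ℝ L
  let d := Module.finrank ℝ L
  let F : (Fin d → ℝ) → X → ℝ := fun v x => ∑ i, v i * (b i : C(X, ℝ)) x
  have hF : Continuous (fun p : X × (Fin d → ℝ) => F p.2 p.1) := by
    refine continuous_finsetSum _ fun i _ => ?_
    exact ((continuous_apply i).comp continuous_snd).mul
      ((b i : C(X, ℝ)).continuous.comp continuous_fst)
  have hFe : ∀ v x, F v x = ((∑ i, v i • b i : L) : C(X, ℝ)) x := by
    intro v x
    simp [F, ContinuousMap.sum_apply]
  have key : ∀ᶠ z in 𝓝 y, ∀ v ∈ Metric.sphere (0 : Fin d → ℝ) 1, ∃ x, f x = z ∧ F v x ≠ 0 := by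
    apply (isCompact_sphere (0 : Fin d → ℝ) 1).eventually_forall_of_forall_eventually
    intro v hv
    obtain ⟨x, hx, hne⟩ : ∃ x, f x = y ∧ F v x ≠ 0 := by
      by_contra hcon
      push Not at hcon
      have h0 := h _ (∑ i, v i • b i : L).2 (fun x hx => by rw [← hFe]; exact hcon x hx)
      have h1 : (∑ i, v i • b i : L) = 0 := Subtype.ext h0
      have h2 : v = 0 := by
        funext i
        exact Fintype.linearIndependent_iff.1 b.linearIndependent v h1 i
      rw [h2] at hv
      simp at hv
    have hopn : IsOpen {p : X × (Fin d → ℝ) | F p.2 p.1 ≠ 0} := isOpen_ne_fun hF continuous_const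
    have him := (hopen.prodMap (IsOpenMap.id (X := Fin d → ℝ))) _ hopn
    have hmem : (y, v) ∈ Prod.map f id '' {p : X × (Fin d → ℝ) | F p.2 p.1 ≠ 0} :=
      ⟨(x, v), hne, by simp [hx]⟩
    filter_upwards [him.mem_nhds hmem]
    rintro _ ⟨⟨x', v'⟩, hne', rfl⟩
    exact ⟨x', rfl, hne'⟩
  filter_upwards [key] with z hz g hg hg0
  by_contra hgne
  let v : Fin d → ℝ := b.repr ⟨g, hg⟩
  have hv : v ≠ 0 := by
    intro hv0
    have : b.repr ⟨g, hg⟩ = 0 := by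
      ext i
      exact congrFun hv0 i
    rw [LinearEquiv.map_eq_zero_iff] at this
    exact hgne (congrArg Subtype.val this)
  obtain ⟨x, hx, hne⟩ := hz (‖v‖⁻¹ • v) (by
    rw [mem_sphere_zero_iff_norm, norm_smul, norm_inv, norm_norm]
    exact inv_mul_cancel₀ (norm_ne_zero_iff.2 hv))
  apply hne
  have h1 : F (‖v‖⁻¹ • v) x = ‖v‖⁻¹ * F v x := by
    simp only [F, Pi.smul_apply, smul_eq_mul, Finset.mul_sum, mul_assoc]
  rw [h1, hFe, b.sum_repr]
  simp [hg0 x hx]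

theorem exists_function_on_fiber {X : Type*} [MetricSpace X] (A : Set X) (hA : A.Infinite)
    (M : Submodule ℝ C(X, ℝ)) [FiniteDimensional ℝ M] :
    ∃ g : C(X, ℝ), ∀ m ∈ M, ∃ x ∈ A, m x ≠ g x := by
  let d := Module.finrank ℝ M
  obtain ⟨t, htA, htc⟩ := hA.exists_subset_card_eq (d + 1)
  let R : C(X, ℝ) →ₗ[ℝ] (t → ℝ) :=
    { toFun := fun g x => g x
      map_add' := fun _ _ => rfl
      map_smul' := fun _ _ => rfl }
  have hne : M.map R ≠ ⊤ := by
    intro htop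
    have h1 : Module.finrank ℝ (M.map R) ≤ d := Submodule.finrank_map_le R M
    rw [htop, finrank_top, Module.finrank_fintype_fun_eq_card, Fintype.card_coe, htc] at h1
    omega
  obtain ⟨v, hv⟩ : ∃ v, v ∉ M.map R := by
    by_contra hcon
    push Not at hcon
    exact hne (Submodule.eq_top_iff'.2 hcon)
  have hcl : IsClosed (t : Set X) := t.finite_toSet.isClosed
  have : DiscreteTopology (t : Set X) := t.finite_toSet.isDiscrete.to_subtype
  let φ : C((t : Set X), ℝ) := ⟨fun x => v ⟨x.1, x.2⟩, continuous_of_discreteTopology⟩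
  obtain ⟨g, hg⟩ := ContinuousMap.exists_restrict_eq hcl φ
  refine ⟨g, fun m hm => ?_⟩
  by_contra hcon
  push Not at hcon
  apply hv
  refine ⟨m, hm, ?_⟩
  funext x
  have h1 : g x = v x := DFunLike.congr_fun hg ⟨x.1, x.2⟩
  rw [← h1]
  exact hcon x.1 (htA x.2)

/-- The state of the recursive construction. -/
structure FibState {X Y : Type*} [TopologicalSpace X] [TopologicalSpace Y] (f : X → Y) where
  L : Y → Set (Submodule ℝ C(X, ℝ))
  fin : ∀ z, (L z).Finite
  usc : ∀ z, ∀ᶠ z' in 𝓝 z, L z' ⊆ L z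
  fd : ∀ z, ∀ K ∈ L z, FiniteDimensional ℝ K
  inj : ∀ z, ∀ K ∈ L z, FibInj f K z
  one : ∀ z, ∀ K ∈ L z, (1 : C(X, ℝ)) ∈ K

theorem fibState_step {X Y : Type*} [MetricSpace X]
    [TopologicalSpace Y] [T2Space Y] [ParacompactSpace Y]
    (f : X → Y) (hopen : IsOpenMap f) (hinf : ∀ y, (f ⁻¹' {y}).Infinite) (s : FibState f) :
    ∃ (W : Y → Set Y) (g : Y → C(X, ℝ)) (s' : FibState f),
      (∀ y, IsOpen (W y)) ∧ (⋃ y, W y = univ) ∧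
      ∀ z y, z ∈ W y → ∀ K ∈ s.L z, g y ∉ K ∧ K ⊔ Submodule.span ℝ {g y} ∈ s'.L z := by
  have hg : ∀ y, ∃ g : C(X, ℝ), ∀ K ∈ s.L y, g ∉ K ∧
      FibInj f (K ⊔ Submodule.span ℝ {g}) y := by
    intro y
    have := (s.fin y).to_subtype
    have : ∀ K : s.L y, FiniteDimensional ℝ (K : Submodule ℝ C(X, ℝ)) := fun K => s.fd y K K.2
    obtain ⟨g, hg⟩ := exists_function_on_fiber (f ⁻¹' {y}) (hinf y)
      (⨆ K : s.L y, (K : Submodule ℝ C(X, ℝ)))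
    have hle : ∀ K ∈ s.L y, K ≤ ⨆ K : s.L y, (K : Submodule ℝ C(X, ℝ)) := fun K hK =>
      le_iSup (fun K : s.L y => (K : Submodule ℝ C(X, ℝ))) ⟨K, hK⟩
    refine ⟨g, fun K hK => ⟨fun hgK => ?_, ?_⟩⟩
    · obtain ⟨x, _, hx⟩ := hg g (hle K hK hgK)
      exact hx rfl
    · intro h hh h0
      obtain ⟨k, hk, w, hw, rfl⟩ := Submodule.mem_sup.1 hh
      obtain ⟨c, rfl⟩ := Submodule.mem_span_singleton.1 hw
      by_cases hc : c = 0
      · subst hc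
        simp only [zero_smul, add_zero] at h0 ⊢
        exact s.inj y K hK k hk h0
      · exfalso
        obtain ⟨x, hxA, hx⟩ := hg ((-c⁻¹) • k) (hle K hK (K.smul_mem _ hk))
        apply hx
        have h1 := h0 x hxA
        simp only [ContinuousMap.add_apply, ContinuousMap.smul_apply, smul_eq_mul] at h1 ⊢
        have h2 : k x = -(c * g x) := by linarith
        rw [h2]
        field_simp
  choose g hg using hg
  let O : Y → Set Y := fun y => {z | s.L z ⊆ s.L y ∧
    ∀ K ∈ s.L y, FibInj f (K ⊔ Submodule.span ℝ {g y}) z}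
  have hO : ∀ y, O y ∈ 𝓝 y := by
    intro y
    have h1 : ∀ᶠ z in 𝓝 y, ∀ K ∈ s.L y, FibInj f (K ⊔ Submodule.span ℝ {g y}) z := by
      rw [Filter.eventually_all_finite (s.fin y)]
      intro K hK
      have := s.fd y K hK
      exact fibInj_eventually hopen _ y (hg y K hK).2
    filter_upwards [s.usc y, h1] with z hz1 hz2
    exact ⟨hz1, hz2⟩
  obtain ⟨v, hvo, hvc, hvf, hvs⟩ := precise_refinement (fun y => interior (O y))
    (fun _ => isOpen_interior)
    (iUnion_eq_univ_iff.2 fun y => ⟨y, mem_interior_iff_mem_nhds.2 (hO y)⟩)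
  obtain ⟨W, hWc, hWo, hWs⟩ := exists_iUnion_eq_closure_subset hvo hvf.point_finite hvc
  have hWO : ∀ y, closure (W y) ⊆ O y := fun y =>
    (hWs y).trans ((hvs y).trans interior_subset)
  have hcf : LocallyFinite (fun y => closure (W y)) := hvf.subset hWs
  refine ⟨W, g,
    { L := fun z => {K' | ∃ K ∈ s.L z, ∃ y, z ∈ closure (W y) ∧
        K' = K ⊔ Submodule.span ℝ {g y}}
      fin := ?_, usc := ?_, fd := ?_, inj := ?_, one := ?_ }, hWo, hWc, ?_⟩
  · intro z
    refine (((s.fin z).prod (hcf.point_finite z)).image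
      (fun p => p.1 ⊔ Submodule.span ℝ {g p.2})).subset ?_
    rintro _ ⟨K, hK, y, hy, rfl⟩
    exact ⟨(K, y), ⟨hK, hy⟩, rfl⟩
  · intro z
    filter_upwards [s.usc z, hcf.eventually_subset (fun _ => isClosed_closure) z] with z' h1 h2
    rintro _ ⟨K, hK, y, hy, rfl⟩
    exact ⟨K, h1 hK, y, h2 hy, rfl⟩
  · rintro z _ ⟨K, hK, y, hy, rfl⟩
    have := s.fd z K hK
    infer_instance
  · rintro z _ ⟨K, hK, y, hy, rfl⟩
    exact (hWO y hy).2 K ((hWO y hy).1 hK)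
  · rintro z _ ⟨K, hK, y, hy, rfl⟩
    exact Submodule.mem_sup_left (s.one z K hK)
  · intro z y hz K hK
    exact ⟨(hg y K ((hWO y (subset_closure hz)).1 hK)).1, K, hK, y, subset_closure hz, rfl⟩

theorem exists_nonconstant {X Y : Type*} [MetricSpace X]
    [TopologicalSpace Y] [T2Space Y] [ParacompactSpace Y] (hY : IsCSpace Y)
    (f : X → Y) (hf : Continuous f) (hopen : IsOpenMap f)
    (hinf : ∀ y, (f ⁻¹' {y}).Infinite) :
    ∃ φ : X → ℝ, Continuous φ ∧ ∀ y, ∃ x x', f x = y ∧ f x' = y ∧ φ x < φ x' := by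
  choose W g nxt hWo hWc hW using fibState_step f hopen hinf
  let s₀ : FibState f :=
    { L := fun _ => {Submodule.span ℝ {(1 : C(X, ℝ))}}
      fin := fun _ => finite_singleton _
      usc := fun _ => Eventually.of_forall fun _ => subset_rfl
      fd := by
        rintro z _ rfl
        infer_instance
      inj := by
        rintro z _ rfl h hh h0
        obtain ⟨c, rfl⟩ := Submodule.mem_span_singleton.1 hh
        obtain ⟨x, hx⟩ := (hinf z).nonempty
        have := h0 x hx
        simp at this
        simp [this]
      one := by
        rintro z _ rfl
        exact Submodule.mem_span_singleton_self _ }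
  let S : ℕ → FibState f := fun n => Nat.rec s₀ (fun _ s => nxt s) n
  have hS : ∀ n, S (n + 1) = nxt (S n) := fun _ => rfl
  obtain ⟨V, hV, hVc⟩ := hY (fun n => range (W (S n))) (fun n =>
    ⟨by rintro _ ⟨y, rfl⟩; exact hWo _ y, by rw [sUnion_range]; exact hWc _⟩)
  let I := Σ n, V n
  have hk : ∀ i : I, ∃ y, (i.2 : Set Y) ⊆ W (S i.1) y := by
    intro i
    obtain ⟨_, ⟨y, rfl⟩, h⟩ := (hV i.1).2.2 i.2 i.2.2
    exact ⟨y, h⟩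
  choose k hk using hk
  obtain ⟨ρ, hρ⟩ := PartitionOfUnity.exists_isSubordinate (isClosed_univ (X := Y))
    (fun i : I => (i.2 : Set Y)) (fun i => (hV i.1).1 i.2 i.2.2) (by
      intro z _
      have hz : z ∈ ⋃₀ (⋃ n, V n) := by rw [hVc]; trivial
      obtain ⟨A, hA, hzA⟩ := hz
      obtain ⟨n, hn⟩ := mem_iUnion.1 hA
      exact mem_iUnion.2 ⟨⟨n, ⟨A, hn⟩⟩, hzA⟩)
  let G : I → C(X, ℝ) := fun i => g (S i.1) (k i)
  have hact : ∀ (i : I) z, ρ i z ≠ 0 → z ∈ (i.2 : Set Y) := fun i z h =>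
    hρ i (subset_tsupport _ h)
  have huniq : ∀ (i j : I) z, ρ i z ≠ 0 → ρ j z ≠ 0 → i.1 = j.1 → i = j := by
    rintro ⟨n, A, hA⟩ ⟨m, B, hB⟩ z hi hj hnm
    obtain rfl : n = m := hnm
    have h1 := hact _ _ hi
    have h2 := hact _ _ hj
    have : A = B := by
      by_contra hne
      exact Set.disjoint_left.1 ((hV n).2.1 hA hB hne) h1 h2
    subst this
    rfl
  refine ⟨fun x => ∑ᶠ i, ρ i (f x) * G i x, ?_, ?_⟩
  · refine continuous_finsum (fun i => ?_) ?_
    · exact ((ρ i).continuous.comp hf).mul (G i).continuous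
    · refine (ρ.locallyFinite.preimage_continuous hf).subset fun i x hx => ?_
      simp only [Function.mem_support, mem_preimage] at hx ⊢
      exact left_ne_zero_of_mul hx
  · intro z
    have hT : {i | ρ i z ≠ 0}.Finite := ρ.locallyFinite.point_finite z
    let T : Finset I := hT.toFinset
    have hTm : ∀ i, i ∈ T ↔ ρ i z ≠ 0 := fun i => by simp [T]
    have hTne : T.Nonempty := by
      obtain ⟨i, hi⟩ := ρ.exists_pos (mem_univ z)
      exact ⟨i, (hTm i).2 hi.ne'⟩
    obtain ⟨i, hiT, hmax⟩ := T.exists_max_image (fun i => i.1) hTne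
    have chain : ∀ n, ∃ K ∈ (S n).L z, ∀ j ∈ T, j.1 < n → G j ∈ K := by
      intro n
      induction n with
      | zero => exact ⟨Submodule.span ℝ {(1 : C(X, ℝ))}, rfl, fun j _ h => absurd h (by omega)⟩
      | succ n ih =>
        obtain ⟨K, hK, hKT⟩ := ih
        by_cases hj : ∃ j ∈ T, j.1 = n
        · obtain ⟨j, hjT, hjn⟩ := hj
          subst hjn
          have hz := hk j (hact j z ((hTm j).1 hjT))
          refine ⟨_, (hW (S j.1) z (k j) hz K hK).2, fun l hl hln => ?_⟩
          rcases Nat.lt_succ_iff_lt_or_eq.1 hln with h | h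
          · exact Submodule.mem_sup_left (hKT l hl h)
          · obtain rfl := huniq l j z ((hTm l).1 hl) ((hTm j).1 hjT) h
            exact Submodule.mem_sup_right (Submodule.mem_span_singleton_self _)
        · obtain ⟨y, hy⟩ := iUnion_eq_univ_iff.1 (hWc (S n)) z
          refine ⟨_, (hW (S n) z y hy K hK).2, fun l hl hln => ?_⟩
          rcases Nat.lt_succ_iff_lt_or_eq.1 hln with h | h
          · exact Submodule.mem_sup_left (hKT l hl h)
          · exact absurd ⟨l, hl, h⟩ hj
    obtain ⟨K, hK, hKT⟩ := chain i.1
    obtain ⟨hnot, hnew⟩ := hW (S i.1) z (k i) (hk i (hact i z ((hTm i).1 hiT))) K hK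
    let Φ : C(X, ℝ) := ∑ j ∈ T, ρ j z • G j
    have hΦ : ∀ x, f x = z → ∑ᶠ j, ρ j (f x) * G j x = Φ x := by
      intro x hx
      rw [hx, finsum_eq_sum_of_support_subset (s := T)]
      · simp [Φ, ContinuousMap.sum_apply]
      · intro j hj
        exact (hTm j).2 (left_ne_zero_of_mul hj)
    have hlow : ∑ j ∈ T.erase i, ρ j z • G j ∈ K := by
      refine K.sum_mem fun j hj => K.smul_mem _ (hKT j (Finset.mem_of_mem_erase hj) ?_)
      refine lt_of_le_of_ne (hmax j (Finset.mem_of_mem_erase hj)) fun h => ?_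
      exact Finset.ne_of_mem_erase hj
        (huniq j i z ((hTm j).1 (Finset.mem_of_mem_erase hj)) ((hTm i).1 hiT) h)
    have hsplit : Φ = ρ i z • G i + ∑ j ∈ T.erase i, ρ j z • G j :=
      (Finset.add_sum_erase T _ hiT).symm
    have hone := (S i.1).one z K hK
    obtain ⟨x₀, hx₀⟩ := (hinf z).nonempty
    obtain ⟨x₁, hx₁, hne⟩ : ∃ x₁, f x₁ = z ∧ Φ x₁ ≠ Φ x₀ := by
      by_contra hcon
      push Not at hcon
      have h0 : Φ - Φ x₀ • (1 : C(X, ℝ)) = 0 := by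
        refine (nxt (S i.1)).inj z _ hnew _ ?_ ?_
        · refine Submodule.sub_mem _ ?_
            (Submodule.mem_sup_left (K.smul_mem _ hone))
          rw [hsplit]
          exact Submodule.add_mem _ (Submodule.mem_sup_right
            (Submodule.smul_mem _ _ (Submodule.mem_span_singleton_self _)))
            (Submodule.mem_sup_left hlow)
        · intro x hx
          simp [hcon x hx]
      apply hnot
      have h1 : ρ i z • G i = Φ x₀ • (1 : C(X, ℝ)) - ∑ j ∈ T.erase i, ρ j z • G j := by
        rw [sub_eq_zero] at h0
        rw [← h0, hsplit, add_sub_cancel_right]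
      have h2 : ρ i z • G i ∈ K := by
        rw [h1]
        exact K.sub_mem (K.smul_mem _ hone) hlow
      exact (K.smul_mem_iff ((hTm i).1 hiT)).1 h2
    rcases lt_or_gt_of_ne hne with h | h
    · exact ⟨x₁, x₀, hx₁, hx₀, by simpa only [hΦ _ hx₁, hΦ x₀ hx₀] using h⟩
    · exact ⟨x₀, x₁, hx₀, hx₁, by simpa only [hΦ _ hx₁, hΦ x₀ hx₀] using h⟩

theorem exists_disjoint_sections {X Y : Type*} [MetricSpace X]
    [TopologicalSpace Y] [T2Space Y] [ParacompactSpace Y] (hY : IsCSpace Y)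
    (f : X → Y) (hf : Continuous f) (hopen : IsOpenMap f)
    (hinf : ∀ y, (f ⁻¹' {y}).Infinite) :
    ∃ U₀ U₁ : Set X, IsOpen U₀ ∧ IsOpen U₁ ∧ f '' U₀ = univ ∧ f '' U₁ = univ ∧
      Disjoint U₀ U₁ := by
  obtain ⟨φ, hφ, hne⟩ := exists_nonconstant hY f hf hopen hinf
  obtain ⟨α, hα⟩ := exists_continuous_forall_mem_convex_of_local_const
    (t := fun y => {a : ℝ | (∃ x, f x = y ∧ φ x < a) ∧ ∃ x, f x = y ∧ a < φ x})
    (fun y => by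
      apply Set.OrdConnected.convex
      refine ⟨fun a ha b hb c hc => ?_⟩
      obtain ⟨⟨x, hx, hxa⟩, -⟩ := ha
      obtain ⟨-, ⟨x', hx', hxb⟩⟩ := hb
      exact ⟨⟨x, hx, hxa.trans_le hc.1⟩, ⟨x', hx', hc.2.trans_lt hxb⟩⟩)
    (fun y => by
      obtain ⟨x, x', hx, hx', hlt⟩ := hne y
      obtain ⟨c, hc1, hc2⟩ := exists_between hlt
      refine ⟨c, ?_⟩
      filter_upwards [(hopen _ (isOpen_lt hφ continuous_const)).mem_nhds ⟨x, hc1, hx⟩,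
        (hopen _ (isOpen_lt continuous_const hφ)).mem_nhds ⟨x', hc2, hx'⟩] with z hz1 hz2
      obtain ⟨u, hu, hu'⟩ := hz1
      obtain ⟨w, hw, hw'⟩ := hz2
      exact ⟨⟨u, hu', hu⟩, ⟨w, hw', hw⟩⟩)
  refine ⟨{x | φ x < α (f x)}, {x | α (f x) < φ x}, isOpen_lt hφ (α.continuous.comp hf),
    isOpen_lt (α.continuous.comp hf) hφ, ?_, ?_, ?_⟩
  · refine eq_univ_of_forall fun y => ?_
    obtain ⟨⟨x, rfl, h⟩, -⟩ := hα y
    exact ⟨x, h, rfl⟩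
  · refine eq_univ_of_forall fun y => ?_
    obtain ⟨-, ⟨x, rfl, h⟩⟩ := hα y
    exact ⟨x, h, rfl⟩
  · refine Set.disjoint_left.2 fun x h1 h2 => ?_
    exact lt_asymm (show φ x < α (f x) from h1) h2

theorem exists_shrunk_section {X Y : Type*} [MetricSpace X]
    [TopologicalSpace Y] [T2Space Y] [ParacompactSpace Y]
    (f : X → Y) (hf : Continuous f) (hopen : IsOpenMap f)
    (U : Set X) (hU : IsOpen U) (hUsec : f '' U = univ) :
    ∃ V : Set X, IsOpen V ∧ f '' V = univ ∧ closure V ⊆ U := by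
  obtain ⟨u, hu, hupos⟩ : ∃ u : X → ℝ, Continuous u ∧ ∀ x, 0 < u x ↔ x ∈ U := by
    rcases (Uᶜ).eq_empty_or_nonempty with h | h
    · rw [compl_empty_iff] at h
      exact ⟨fun _ => 1, continuous_const, fun x => by simp [h]⟩
    · refine ⟨fun x => Metric.infDist x Uᶜ, Metric.continuous_infDist_pt _, fun x => ?_⟩
      rw [← hU.isClosed_compl.notMem_iff_infDist_pos h]
      simp
  obtain ⟨α, hα⟩ := exists_continuous_forall_mem_convex_of_local_const
    (t := fun y => {a : ℝ | 0 < a ∧ ∃ x, f x = y ∧ a < u x})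
    (fun y => by
      apply Set.OrdConnected.convex
      refine ⟨fun a ha b hb c hc => ?_⟩
      obtain ⟨-, ⟨x', hx', hxb⟩⟩ := hb
      exact ⟨ha.1.trans_le hc.1, ⟨x', hx', hc.2.trans_lt hxb⟩⟩)
    (fun y => by
      obtain ⟨x, hx, hxy⟩ : y ∈ f '' U := by rw [hUsec]; trivial
      obtain ⟨c, hc1, hc2⟩ := exists_between ((hupos x).2 hx)
      refine ⟨c, ?_⟩
      filter_upwards [(hopen _ (isOpen_lt continuous_const hu)).mem_nhds ⟨x, hc2, hxy⟩] with z hz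
      obtain ⟨w, hw, hw'⟩ := hz
      exact ⟨hc1, ⟨w, hw', hw⟩⟩)
  refine ⟨{x | α (f x) < u x}, isOpen_lt (α.continuous.comp hf) hu, ?_, ?_⟩
  · refine eq_univ_of_forall fun y => ?_
    obtain ⟨-, ⟨x, rfl, h⟩⟩ := hα y
    exact ⟨x, h, rfl⟩
  · intro x hx
    have h1 : α (f x) ≤ u x := closure_lt_subset_le (α.continuous.comp hf) hu hx
    exact (hupos x).1 ((hα (f x)).1.trans_le h1)

theorem statement10 {X Y : Type*} [MetricSpace X]
    [TopologicalSpace Y] [T2Space Y] [ParacompactSpace Y] (hY : IsCSpace Y)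
    (f : X → Y) (hf : Continuous f) (hopen : IsOpenMap f) (hsurj : Function.Surjective f)
    (hdense : ∀ y : Y, ∀ x ∈ f ⁻¹' {y}, AccPt x (𝓟 (f ⁻¹' {y})))
    (hcompl : ∀ y : Y, IsComplete (f ⁻¹' {y}))
    (U : Set X) (hU : IsOpen U) (hUsec : f '' U = Set.univ) :
    ∃ U₀ U₁ : Set X, IsOpen U₀ ∧ IsOpen U₁ ∧ f '' U₀ = Set.univ ∧ f '' U₁ = Set.univ ∧
      Disjoint U₀ U₁ ∧ closure U₀ ⊆ U ∧ closure U₁ ⊆ U := by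
  obtain ⟨V, hVo, hVs, hVU⟩ := exists_shrunk_section f hf hopen U hU hUsec
  have hinf : ∀ y, ((fun x : V => f x) ⁻¹' {y}).Infinite := by
    intro y
    obtain ⟨x, hxV, hxy⟩ : y ∈ f '' V := by rw [hVs]; trivial
    have hacc := (hdense y x hxy).nhds_inter (hVo.mem_nhds hxV)
    have h1 := Set.Infinite.of_accPt hacc
    intro hfin
    refine h1 ((hfin.image Subtype.val).subset ?_)
    rintro w ⟨hwV, hwy⟩
    exact ⟨⟨w, hwV⟩, hwy, rfl⟩
  obtain ⟨A, B, hA, hB, hAs, hBs, hAB⟩ := exists_disjoint_sections hY (fun x : V => f x)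
    (hf.comp continuous_subtype_val) (hopen.comp hVo.isOpenMap_subtype_val) hinf
  have hsub : ∀ A : Set V, closure (Subtype.val '' A) ⊆ U := fun A =>
    (closure_mono (by rintro _ ⟨a, _, rfl⟩; exact a.2)).trans hVU
  refine ⟨Subtype.val '' A, Subtype.val '' B, hVo.isOpenMap_subtype_val _ hA,
    hVo.isOpenMap_subtype_val _ hB, ?_, ?_, ?_, hsub A, hsub B⟩
  · rw [image_image]; exact hAs
  · rw [image_image]; exact hBs
  · exact (disjoint_image_iff Subtype.val_injective).2 hAB
end

section
/- Let (X,d) be a metric space, Y a paracompact Hausdorff C-space, and f : X → Y an open continuous surjection. Then for every ε > 0, every open section G for f contains an open section U for f with mesh_d(U,f) ≤ ε and td_d(U,f) ≤ ε. -/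
open Set Topology Filter

/-- `δ(F,X)`: the infimum of `{1}` together with all `ε > 0` such that `F` is contained
in the `ε`-neighbourhood of some nonempty finite subset `S ⊆ F`. -/
noncomputable def deltaF {X : Type*} [MetricSpace X] (F : Set X) : ℝ :=
  sInf ({1} ∪ {ε : ℝ | 0 < ε ∧ ∃ S : Finset X, S.Nonempty ∧ ↑S ⊆ F ∧
    F ⊆ ⋃ s ∈ S, Metric.ball s ε})

/-- The `d`-mesh of `U` with respect to `f`: `sup{δ(f⁻¹(y) ∩ U, X) : y}`. -/
noncomputable def meshd {X Y : Type*} [MetricSpace X] (f : X → Y) (U : Set X) : ℝ :=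
  ⨆ y : Y, deltaF (f ⁻¹' {y} ∩ U)

/-- `td_d(F)`: supremum of the diameters of connected subsets of `F`. -/
noncomputable def tdF {X : Type*} [MetricSpace X] (F : Set X) : ENNReal :=
  ⨆ (C : Set X) (_ : C ⊆ F ∧ IsConnected C), EMetric.diam C

/-- `td_d(U,f) = sup{td_d(f⁻¹(y) ∩ U) : y}`. -/
noncomputable def tdd {X Y : Type*} [MetricSpace X] (f : X → Y) (U : Set X) : ENNReal :=
  ⨆ y : Y, tdF (f ⁻¹' {y} ∩ U)

/-- A connected set covered by countably many balls with small total diameter is small. -/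
lemma conn_dist_le {X : Type*} [MetricSpace X] (ε : ℝ) (hε : 0 < ε) (C : Set X)
    (hC : IsPreconnected C) (c : ℕ → X)
    (hcov : C ⊆ ⋃ n, Metric.ball (c n) (ε / 2 / 2 / 2 ^ n)) (a b : X) (ha : a ∈ C) (hb : b ∈ C) :
    edist a b ≤ ENNReal.ofReal ε := by
  have hI : Set.Icc 0 (dist a b) ⊆ (fun x => dist a x) '' C := by
    have h := (hC.image (fun x => dist a x) (by fun_prop)).ordConnected
    apply h.out
    · exact ⟨a, ha, by simp⟩
    · exact ⟨b, hb, rfl⟩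
  have hJ : Set.Icc 0 (dist a b) ⊆
      ⋃ n, Set.Ioo (dist a (c n) - ε / 2 / 2 / 2 ^ n) (dist a (c n) + ε / 2 / 2 / 2 ^ n) := by
    intro t ht
    obtain ⟨x, hx, rfl⟩ := hI ht
    obtain ⟨n, hn⟩ := Set.mem_iUnion.1 (hcov hx)
    refine Set.mem_iUnion.2 ⟨n, ?_, ?_⟩
    · have := dist_triangle a x (c n)
      have := Metric.mem_ball.1 hn
      dsimp only
      linarith
    · have := dist_triangle a (c n) x
      have := Metric.mem_ball'.1 hn
      dsimp only
      linarith
  have h1 := (MeasureTheory.measure_mono (μ := MeasureTheory.volume) hJ).trans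
    (MeasureTheory.measure_iUnion_le _)
  rw [Real.volume_Icc, sub_zero, ← edist_dist] at h1
  refine h1.trans ?_
  have h2 : ∀ n : ℕ, MeasureTheory.volume
      (Set.Ioo (dist a (c n) - ε / 2 / 2 / 2 ^ n) (dist a (c n) + ε / 2 / 2 / 2 ^ n))
      = ENNReal.ofReal (ε / 2 / 2 ^ n) := by
    intro n
    rw [Real.volume_Ioo]
    congr 1
    ring
  simp_rw [h2]
  rw [← ENNReal.ofReal_tsum_of_nonneg (fun n => by positivity) (summable_geometric_two' ε),
    tsum_geometric_two']

theorem statement11 {X Y : Type*} [MetricSpace X]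
    [TopologicalSpace Y] [T2Space Y] [ParacompactSpace Y] (hY : IsCSpace Y)
    (f : X → Y) (hf : Continuous f) (hopen : IsOpenMap f) (hsurj : Function.Surjective f)
    (ε : ℝ) (hε : 0 < ε) (G : Set X) (hG : IsOpen G) (hGsec : f '' G = Set.univ) :
    ∃ U : Set X, U ⊆ G ∧ IsOpen U ∧ f '' U = Set.univ ∧
      meshd f U ≤ ε ∧ tdd f U ≤ ENNReal.ofReal ε := by
  have hr : ∀ n : ℕ, 0 < ε / 2 / 2 / 2 ^ n := fun n => by positivity
  have hrle : ∀ n : ℕ, 2 * (ε / 2 / 2 / 2 ^ n) ≤ ε := fun n => by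
    have : ε / 2 / 2 / 2 ^ n ≤ ε / 2 / 2 :=
      div_le_self (by positivity) (one_le_pow₀ (by norm_num))
    linarith
  obtain ⟨V, hV, hVc⟩ := hY
    (fun n => {W | IsOpen W ∧ ∃ x, W ⊆ f '' (Metric.ball x (ε / 2 / 2 / 2 ^ n) ∩ G)}) (by
      intro n
      refine ⟨fun U hU => hU.1, Set.eq_univ_of_forall fun y => ?_⟩
      obtain ⟨x, hx, rfl⟩ := (hGsec ▸ Set.mem_univ y : y ∈ f '' G)
      exact ⟨_, ⟨hopen _ (Metric.isOpen_ball.inter hG), x, subset_rfl⟩,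
        x, ⟨Metric.mem_ball_self (hr n), hx⟩, rfl⟩)
  have hx : ∀ n, ∀ W : V n, ∃ x,
      (W : Set Y) ⊆ f '' (Metric.ball x (ε / 2 / 2 / 2 ^ n) ∩ G) := by
    intro n W
    obtain ⟨W', ⟨_, x, hx⟩, h⟩ := (hV n).2.2 W W.2
    exact ⟨x, h.trans hx⟩
  choose x hx using hx
  obtain ⟨O, hO, hOc, hOf, hOs⟩ := precise_refinement (fun n => ⋃₀ V n)
    (fun n => isOpen_sUnion (hV n).1) (by
      rw [← hVc, Set.sUnion_iUnion])
  let P : ℕ → Set X := fun n => f ⁻¹' O n ∩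
    ⋃ W : V n, f ⁻¹' (W : Set Y) ∩ (Metric.ball (x n W) (ε / 2 / 2 / 2 ^ n) ∩ G)
  have hP : ∀ n, ∀ y, ∃ c, f ⁻¹' {y} ∩ P n ⊆ Metric.ball c (ε / 2 / 2 / 2 ^ n) := by
    intro n y
    rcases Set.eq_empty_or_nonempty (f ⁻¹' {y} ∩ P n) with h | ⟨z, hz, hzO, hzP⟩
    · obtain ⟨c, _⟩ := hsurj y
      exact ⟨c, h ▸ Set.empty_subset _⟩
    · obtain ⟨W, hW, _⟩ := Set.mem_iUnion.1 hzP
      refine ⟨x n W, ?_⟩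
      rintro w ⟨hw, _, hwP⟩
      obtain ⟨W', hW', hb, _⟩ := Set.mem_iUnion.1 hwP
      have : W = W' := by
        by_contra hne
        have hd := (hV n).2.1 W.2 W'.2 (fun h => hne (Subtype.ext h))
        refine Set.disjoint_left.1 hd hW ?_
        rw [show f z = y from hz, ← show f w = y from hw]
        exact hW'
      rw [this]
      exact hb
  have hUsec : f '' (⋃ n, P n) = Set.univ := by
    refine Set.eq_univ_of_forall fun y => ?_
    obtain ⟨n, hn⟩ := Set.mem_iUnion.1 (hOc ▸ Set.mem_univ y : y ∈ ⋃ i, O i)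
    obtain ⟨W, hW, hyW⟩ := hOs n hn
    obtain ⟨z, hz, rfl⟩ := hx n ⟨W, hW⟩ hyW
    exact ⟨z, Set.mem_iUnion.2 ⟨n, hn, Set.mem_iUnion.2 ⟨⟨W, hW⟩, hyW, hz⟩⟩, rfl⟩
  refine ⟨⋃ n, P n, ?_, ?_, hUsec, ?_, ?_⟩
  · refine Set.iUnion_subset fun n z hz => ?_
    obtain ⟨W, _, _, h⟩ := Set.mem_iUnion.1 hz.2
    exact h
  · refine isOpen_iUnion fun n => ((hO n).preimage hf).inter (isOpen_iUnion fun W => ?_)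
    exact (((hV n).1 W W.2).preimage hf).inter (Metric.isOpen_ball.inter hG)
  · refine Real.iSup_le (fun y => ?_) hε.le
    refine csInf_le ⟨0, ?_⟩ (Or.inr ⟨hε, ?_⟩)
    · rintro t (rfl | ht)
      · exact zero_le_one
      · exact ht.1.le
    · have hT : {n | y ∈ O n}.Finite := hOf.point_finite y
      have hs : ∀ n, ∃ s, (f ⁻¹' {y} ∩ P n).Nonempty → s ∈ f ⁻¹' {y} ∩ P n := by
        intro n
        obtain ⟨c, _⟩ := hsurj y
        by_cases h : (f ⁻¹' {y} ∩ P n).Nonempty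
        · exact ⟨h.some, fun _ => h.some_mem⟩
        · exact ⟨c, fun h' => absurd h' h⟩
      choose s hs using hs
      have hT' : {n | (f ⁻¹' {y} ∩ P n).Nonempty}.Finite := by
        refine hT.subset ?_
        rintro n ⟨z, hz, hzO, _⟩
        rw [Set.mem_setOf_eq, ← show f z = y from hz]
        exact hzO
      classical
      refine ⟨hT'.toFinset.image s, ?_, ?_, ?_⟩
      · obtain ⟨z, hz, hzy⟩ := (hUsec ▸ Set.mem_univ y : y ∈ f '' (⋃ n, P n))
        obtain ⟨n, hn⟩ := Set.mem_iUnion.1 hz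
        exact ⟨s n, Finset.mem_image_of_mem _ (hT'.mem_toFinset.2 ⟨z, hzy, hn⟩)⟩
      · intro w hw
        obtain ⟨n, hn, rfl⟩ := Finset.mem_image.1 (Finset.mem_coe.1 hw)
        have := hs n (hT'.mem_toFinset.1 hn)
        exact ⟨this.1, Set.mem_iUnion.2 ⟨n, this.2⟩⟩
      · rintro z ⟨hz, hzP⟩
        obtain ⟨n, hn⟩ := Set.mem_iUnion.1 hzP
        have hne : (f ⁻¹' {y} ∩ P n).Nonempty := ⟨z, hz, hn⟩
        obtain ⟨c, hc⟩ := hP n y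
        have h1 := Metric.mem_ball.1 (hc ⟨hz, hn⟩)
        have h2 := Metric.mem_ball'.1 (hc (hs n hne))
        refine Set.mem_biUnion (x := s n)
          (Finset.mem_coe.2 (Finset.mem_image_of_mem _ (hT'.mem_toFinset.2 hne))) ?_
        rw [Metric.mem_ball]
        have := dist_triangle z c (s n)
        have := hrle n
        linarith
  · refine iSup_le fun y => iSup₂_le fun C hC => EMetric.diam_le fun a ha b hb => ?_
    choose c hc using fun n => hP n y
    refine conn_dist_le ε hε C hC.2.isPreconnected c ?_ a b ha hb
    intro z hz
    obtain ⟨n, hn⟩ := Set.mem_iUnion.1 (hC.1 hz).2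
    exact Set.mem_iUnion.2 ⟨n, hc n ⟨(hC.1 hz).1, hn⟩⟩
end

section
/- Let (X,d) be a metric space, Y a paracompact Hausdorff C-space, f : X → Y an open continuous surjection such that each fiber f⁻¹(y) is dense in itself (has no isolated points) and d-complete, and U an open section for f. Then there exists a map h assigning to each nonempty finite binary sequence t ∈ 2^{<ω} an open section h(t) for f such that, for any two distinct sequences s, t ∈ 2^{<ω}: (a) closure(h(t)) ⊂ h(s) ⊂ U whenever s is a proper initial segment of t; (b) h(s) ∩ h(t) = ∅ whenever s and t are incomparable (neither is an initial segment of the other); (c) for every t of length n+1, mesh_d(h(t),f) ≤ 2⁻ⁿ and td_d(h(t),f) ≤ 2⁻ⁿ. -/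
open Set Topology Filter

theorem aux_ediam {X : Type*} [MetricSpace X] (C : Set X) (hC : IsConnected C) (D : ℕ → Set X)
    (ρ : ℕ → ENNReal) (hD : ∀ n, Metric.ediam (D n) ≤ ρ n) (hCD : C ⊆ ⋃ n, D n) :
    Metric.ediam C ≤ ∑' n, ρ n := by
  refine Metric.ediam_le ?_
  intro a ha b hb
  let φ : X → ℝ := fun x => dist a x
  have hφ : LipschitzWith 1 φ := LipschitzWith.dist_right a
  have hpre : IsPreconnected (φ '' C) := hC.isPreconnected.image _ hφ.continuous.continuousOn
  have hI : Icc 0 (dist a b) ⊆ φ '' C := by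
    have := hpre.Icc_subset (mem_image_of_mem φ ha) (mem_image_of_mem φ hb)
    simpa [φ] using this
  have hsub : Icc 0 (dist a b) ⊆ ⋃ n, φ '' (D n) := by
    rw [← image_iUnion]; exact hI.trans (image_mono hCD)
  calc edist a b = MeasureTheory.volume (Icc 0 (dist a b)) := by
        rw [Real.volume_Icc, sub_zero, edist_dist]
    _ ≤ ∑' n, MeasureTheory.volume (φ '' (D n)) :=
        (MeasureTheory.measure_mono hsub).trans (MeasureTheory.measure_iUnion_le _)
    _ ≤ ∑' n, ρ n := by
        refine ENNReal.tsum_le_tsum fun n => ?_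
        refine (Real.volume_le_diam _).trans (le_trans ?_ (hD n))
        simpa using hφ.ediam_image_le (D n)

def aux_A {X : Type*} [MetricSpace X] (ι : Type) (n : ℕ) : Set ((ℕ → ℝ) × (ι → X)) :=
  {p | ∀ c : ι → Fin n, ∃ i j, c i = c j ∧ p.1 (c i) < dist (p.2 i) (p.2 j)}

theorem aux_A_open {X : Type*} [MetricSpace X] (ι : Type) [Finite ι] (n : ℕ) :
    IsOpen (aux_A (X := X) ι n) := by
  have : aux_A (X := X) ι n = ⋂ c : ι → Fin n, ⋃ i, ⋃ j, ⋃ _ : c i = c j,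
      {p | p.1 (c i) < dist (p.2 i) (p.2 j)} := by
    ext p; simp [aux_A]
  rw [this]
  refine isOpen_iInter_of_finite fun c => isOpen_iUnion fun i => isOpen_iUnion fun j =>
    isOpen_iUnion fun _ => ?_
  exact isOpen_lt (by fun_prop) (by fun_prop)

def aux_P {X Y : Type*} [MetricSpace X] (f : X → Y) (U : Set X) (n : ℕ) (ρ : ℕ → ℝ) (y : Y) :
    Prop :=
  ∃ (ι : Type) (_ : Finite ι) (x : ι → X), (∀ i, f (x i) = y ∧ x i ∈ U) ∧ (ρ, x) ∈ aux_A ι n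

theorem aux_P_mono {X Y : Type*} [MetricSpace X] (f : X → Y) (U : Set X) (n : ℕ) (ρ ρ' : ℕ → ℝ)
    (y : Y) (h : ∀ k < n, ρ' k ≤ ρ k) (hP : aux_P f U n ρ y) : aux_P f U n ρ' y := by
  obtain ⟨ι, hι, x, hx, hA⟩ := hP
  refine ⟨ι, hι, x, hx, fun c => ?_⟩
  obtain ⟨i, j, hij, hlt⟩ := hA c
  exact ⟨i, j, hij, (h _ (c i).2).trans_lt hlt⟩

theorem aux_P_open {X Y : Type*} [MetricSpace X] [TopologicalSpace Y] (f : X → Y)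
    (hopen : IsOpenMap f) (U : Set X) (hU : IsOpen U) (n : ℕ) (r : ℕ → C(Y, ℝ)) (y : Y)
    (hP : aux_P f U n (fun k => r k y) y) : ∀ᶠ y' in 𝓝 y, aux_P f U n (fun k => r k y') y' := by
  obtain ⟨ι, hι, x, hx, hA⟩ := hP
  have h1 : ∀ᶠ p in 𝓝 (y, x), ((fun k => r k p.1), p.2) ∈ aux_A (X := X) ι n := by
    have hc : Continuous fun p : Y × (ι → X) => ((fun k => r k p.1 : ℕ → ℝ), p.2) := by fun_prop
    exact hc.continuousAt.eventually ((aux_A_open ι n).mem_nhds hA)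
  rw [nhds_prod_eq] at h1
  obtain ⟨pa, ha, pb, hb, hab⟩ := eventually_prod_iff.1 h1
  have hUx : ∀ᶠ x' in 𝓝 x, ∀ i, x' i ∈ U := by
    rw [eventually_all]
    intro i
    exact (continuous_apply i).continuousAt.eventually (hU.mem_nhds (hx i).2)
  have hM := (IsOpenMap.piMap (f := fun _ : ι => f) (fun _ => hopen) (by simp)).image_mem_nhds
    (hb.and hUx)
  have hcst : Pi.map (fun _ : ι => f) x = fun _ => y := funext fun i => (hx i).1
  rw [hcst] at hM
  have hcc : Continuous fun y' : Y => (fun _ : ι => y') := by fun_prop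
  filter_upwards [ha, hcc.continuousAt.eventually hM] with y' h1 h2
  obtain ⟨x', ⟨h3, h4⟩, h5⟩ := h2
  exact ⟨ι, hι, x', fun i => ⟨congrFun h5 i, h4 i⟩, hab h1 h3⟩

theorem aux_P_ext {X Y : Type*} [MetricSpace X] (f : X → Y)
    (U : Set X) (hU : IsOpen U)
    (hdense : ∀ y : Y, ∀ x ∈ f ⁻¹' {y}, AccPt x (𝓟 (f ⁻¹' {y}))) (n : ℕ) (ρ : ℕ → ℝ) (y : Y)
    (hP : aux_P f U n ρ y) : ∃ σ : ℝ, 0 < σ ∧ aux_P f U (n+1) (Function.update ρ n σ) y := by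
  obtain ⟨ι, hι, x, hx, hA⟩ := hP
  have h1 : ∀ᶠ x' in 𝓝 x, (ρ, x') ∈ aux_A (X := X) ι n := by
    have hc : Continuous fun x' : ι → X => (ρ, x') := by fun_prop
    exact hc.continuousAt.eventually ((aux_A_open ι n).mem_nhds hA)
  rw [nhds_pi, Filter.eventually_iff, Filter.mem_pi] at h1
  obtain ⟨I, -, t, ht, hsub⟩ := h1
  have h2 : ∀ i, ∃ z, z ∈ t i ∧ z ∈ U ∧ f z = y ∧ z ≠ x i := by
    intro i
    have := (accPt_iff_nhds.1 (hdense y (x i) (hx i).1)) (t i ∩ U)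
      (inter_mem (ht i) (hU.mem_nhds (hx i).2))
    obtain ⟨z, ⟨⟨h3, h4⟩, h5⟩, h6⟩ := this
    exact ⟨z, h3, h4, h5, h6⟩
  choose z hz1 hz2 hz3 hz4 using h2
  have h3 : ∃ σ : ℝ, 0 < σ ∧ ∀ i, σ < dist (x i) (z i) := by
    have : ∀ᶠ σ in 𝓝[>] (0:ℝ), 0 < σ ∧ ∀ i, σ < dist (x i) (z i) := by
      refine (eventually_mem_nhdsWithin).and ?_
      rw [eventually_all]
      intro i
      exact nhdsWithin_le_nhds (Iio_mem_nhds (dist_pos.2 (hz4 i).symm))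
    exact this.exists
  obtain ⟨σ, hσ, hσz⟩ := h3
  refine ⟨σ, hσ, ι × Bool, inferInstance, fun p => if p.2 then x p.1 else z p.1, ?_, ?_⟩
  · rintro ⟨i, b⟩
    cases b
    · exact ⟨hz3 i, hz2 i⟩
    · exact hx i
  · intro c
    by_cases hc : ∃ i, ∀ b, (c (i, b)).1 = n
    · obtain ⟨i, hi⟩ := hc
      refine ⟨(i, true), (i, false), Fin.ext ((hi _).trans (hi _).symm), ?_⟩
      simp [hi, hσz]
    · push Not at hc
      choose b hb using hc
      have hlt : ∀ i, (c (i, b i)).1 < n := fun i => by have := (c (i, b i)).2; have := hb i; omega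
      have hm : (fun i => if b i then x i else z i) ∈ I.pi t := by
        intro i _
        cases h : b i
        · simpa [h] using hz1 i
        · simpa [h] using mem_of_mem_nhds (ht i)
      obtain ⟨i, j, hij, h5⟩ := hsub hm fun i => ⟨_, hlt i⟩
      refine ⟨(i, b i), (j, b j), Fin.ext (by simpa using hij), ?_⟩
      simpa [Function.update_of_ne (hb i)] using h5

theorem aux_step {X Y : Type*} [MetricSpace X] [TopologicalSpace Y] [T2Space Y]
    [ParacompactSpace Y] (f : X → Y) (hopen : IsOpenMap f) (U : Set X) (hU : IsOpen U)
    (hdense : ∀ y : Y, ∀ x ∈ f ⁻¹' {y}, AccPt x (𝓟 (f ⁻¹' {y}))) (n : ℕ) (r : ℕ → C(Y, ℝ))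
    (hP : ∀ y, aux_P f U n (fun k => r k y) y) :
    ∃ s : C(Y, ℝ), (∀ y, 0 < s y) ∧
      ∀ y, aux_P f U (n + 1) (fun k => Function.update r n s k y) y := by
  have hupd : ∀ (s : C(Y, ℝ)) (y : Y), (fun k => Function.update r n s k y) =
      Function.update (fun k => r k y) n (s y) := by
    intro s y
    funext k
    by_cases hk : k = n
    · subst hk; simp
    · simp [Function.update_of_ne hk]
  let t : Y → Set ℝ := fun y => {σ | 0 < σ ∧ aux_P f U (n+1) (Function.update (fun k => r k y) n σ) y}
  have ht : ∀ y, Convex ℝ (t y) := by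
    intro y
    apply Set.OrdConnected.convex
    refine ⟨?_⟩
    rintro a ⟨ha, -⟩ b ⟨-, hb⟩ c ⟨hac, hcb⟩
    refine ⟨ha.trans_le hac, aux_P_mono f U _ _ _ y ?_ hb⟩
    intro k _
    by_cases hk : k = n
    · subst hk; simpa using hcb
    · simp [Function.update_of_ne hk]
  obtain ⟨s, hs⟩ := exists_continuous_forall_mem_convex_of_local_const ht (by
    intro y
    obtain ⟨σ, hσ, h⟩ := aux_P_ext f U hU hdense n _ y (hP y)
    refine ⟨σ, ?_⟩
    have := aux_P_open f hopen U hU (n+1) (Function.update r n (ContinuousMap.const Y σ)) y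
      (by rw [hupd]; exact h)
    filter_upwards [this] with y' hy'
    rw [hupd] at hy'
    exact ⟨hσ, hy'⟩)
  refine ⟨s, fun y => (hs y).1, fun y => ?_⟩
  rw [hupd]
  exact (hs y).2

theorem aux_seq {X Y : Type*} [MetricSpace X] [TopologicalSpace Y] [T2Space Y]
    [ParacompactSpace Y] (f : X → Y) (hopen : IsOpenMap f) (U : Set X) (hU : IsOpen U)
    (hUsec : f '' U = Set.univ)
    (hdense : ∀ y : Y, ∀ x ∈ f ⁻¹' {y}, AccPt x (𝓟 (f ⁻¹' {y}))) :
    ∃ r : ℕ → C(Y, ℝ), (∀ n y, 0 < r n y) ∧ ∀ n y, aux_P f U n (fun k => r k y) y := by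
  have h0 : ∀ y, aux_P f U 0 (fun k => (0 : ℕ → C(Y, ℝ)) k y) y := by
    intro y
    obtain ⟨x, hx, hxy⟩ := hUsec.ge (mem_univ y)
    exact ⟨Unit, inferInstance, fun _ => x, fun _ => ⟨hxy, hx⟩, fun c => (c ()).elim0⟩
  choose S hS1 hS2 using aux_step f hopen U hU hdense
  let R : (n : ℕ) → {r : ℕ → C(Y, ℝ) // ∀ y, aux_P f U n (fun k => r k y) y} := fun n =>
    Nat.rec ⟨0, h0⟩ (fun n r => ⟨Function.update r.1 n (S n r.1 r.2), hS2 n r.1 r.2⟩) n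
  have hR : ∀ n, (R (n+1)).1 = Function.update (R n).1 n (S n (R n).1 (R n).2) := fun n => rfl
  have hst : ∀ n k, k < n → (R n).1 k = (R (k+1)).1 k := by
    intro n
    induction n with
    | zero => intro k hk; omega
    | succ n ih =>
      intro k hk
      by_cases h : k = n
      · subst h; rfl
      · rw [hR, Function.update_of_ne h, ih k (by omega)]
  refine ⟨fun n => (R (n+1)).1 n, fun n y => ?_, fun n y => ?_⟩
  · beta_reduce
    rw [hR, Function.update_self]
    exact hS1 _ _ _ y
  · refine aux_P_mono f U n _ _ y ?_ ((R n).2 y)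
    intro k hk
    simp only [hst n k hk, le_refl]

theorem aux_main {X Y : Type*} [MetricSpace X] [TopologicalSpace Y] [T2Space Y]
    [ParacompactSpace Y] (hY : ∀ W : ℕ → Set (Set Y),
    (∀ n, (∀ U ∈ W n, IsOpen U) ∧ ⋃₀ W n = Set.univ) →
    ∃ V : ℕ → Set (Set Y),
      (∀ n, (∀ U ∈ V n, IsOpen U) ∧ (V n).Pairwise Disjoint ∧
        ∀ U ∈ V n, ∃ W' ∈ W n, U ⊆ W') ∧
      ⋃₀ (⋃ n, V n) = Set.univ) (f : X → Y) (hf : Continuous f) (hopen : IsOpenMap f)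
    (U : Set X) (hU : IsOpen U) (hUsec : f '' U = Set.univ)
    (r : ℕ → C(Y, ℝ)) (hr : ∀ n y, 0 < r n y) :
    ∃ G : Set X, IsOpen G ∧ f '' G = Set.univ ∧ closure G ⊆ U ∧
      ∀ y, ∃ (M : ℕ) (D : ℕ → Set X), (∀ n, ∀ a ∈ D n, ∀ b ∈ D n, dist a b ≤ r n y) ∧
        ∀ x ∈ closure G, f x = y → ∃ n < M, x ∈ D n := by
  obtain ⟨V, hV, hVc⟩ := hY (fun n => {W | IsOpen W ∧ ∃ B : Set X, IsOpen B ∧ W ⊆ f '' B ∧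
    closure B ⊆ U ∧ ∀ y ∈ W, ∀ a ∈ closure B, ∀ b ∈ closure B, dist a b ≤ r n y}) (by
    intro n
    refine ⟨fun W hW => hW.1, eq_univ_of_forall fun y => ?_⟩
    obtain ⟨x, hx, hxy⟩ := hUsec.ge (mem_univ y)
    obtain ⟨δ, hδ, hδU⟩ := Metric.nhds_basis_closedBall.mem_iff.1 (hU.mem_nhds hx)
    set η := min δ (r n y / 4) with hη
    have hηpos : 0 < η := lt_min hδ (by have := hr n y; linarith)
    have hη4 : η ≤ r n y / 4 := min_le_right _ _
    have hcl : closure (Metric.ball x η) ⊆ Metric.closedBall x η := Metric.closure_ball_subset_closedBall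
    refine ⟨f '' (Metric.ball x η) ∩ {y' | r n y / 2 < r n y'}, ⟨?_, Metric.ball x η,
      Metric.isOpen_ball, inter_subset_left, ?_, ?_⟩, ?_, ?_⟩
    · exact (hopen _ Metric.isOpen_ball).inter (isOpen_lt (by fun_prop) (by fun_prop))
    · exact hcl.trans ((Metric.closedBall_subset_closedBall (min_le_left _ _)).trans hδU)
    · rintro y' ⟨-, hy'⟩ a ha b hb
      have h1 := Metric.mem_closedBall.1 (hcl ha)
      have h2 := Metric.mem_closedBall.1 (hcl hb)
      have h3 := dist_triangle_right a b x
      simp only [mem_ofPred_eq] at hy'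
      linarith
    · exact ⟨x, Metric.mem_ball_self hηpos, hxy⟩
    · have := hr n y
      simp only [mem_ofPred_eq]; linarith)
  have hB : ∀ n, ∀ v : Set Y, ∃ B : Set X, v ∈ V n → (IsOpen B ∧ v ⊆ f '' B ∧
    closure B ⊆ U ∧ ∀ y ∈ v, ∀ a ∈ closure B, ∀ b ∈ closure B, dist a b ≤ r n y) := by
    intro n v
    by_cases hv : v ∈ V n
    · obtain ⟨W, ⟨-, B, h1, h2, h3, h4⟩, hvW⟩ := (hV n).2.2 v hv
      exact ⟨B, fun _ => ⟨h1, hvW.trans h2, h3, fun y hy => h4 y (hvW hy)⟩⟩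
    · exact ⟨∅, fun h => absurd h hv⟩
  choose B hB using hB
  have huniq : ∀ n, ∀ v ∈ V n, ∀ w ∈ V n, ∀ y, y ∈ v → y ∈ w → v = w := by
    intro n v hv w hw y hyv hyw
    by_contra hne
    exact Set.disjoint_left.1 ((hV n).2.1 hv hw hne) hyv hyw
  obtain ⟨G', hG'o, hG'c, hG'lf, hG's⟩ := precise_refinement (fun n => ⋃₀ V n)
    (fun n => isOpen_sUnion (hV n).1) (by rw [← hVc, sUnion_iUnion])
  obtain ⟨E, hEc, hEo, hEcl⟩ := exists_iUnion_eq_closure_subset hG'o hG'lf.point_finite hG'c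
  have hElf : LocallyFinite E := hG'lf.subset fun n => subset_closure.trans (hEcl n)
  let P : ℕ → Set X := fun n => ⋃ v ∈ V n, (f ⁻¹' v ∩ B n v)
  have hPo : ∀ n, IsOpen (P n) := fun n => isOpen_biUnion fun v hv =>
    (((hV n).1 v hv).preimage hf).inter (hB n v hv).1
  let Q : ℕ → Set X := fun n => P n ∩ f ⁻¹' (E n)
  have hQlf : LocallyFinite Q := (hElf.preimage_continuous hf).subset fun n => inter_subset_right
  have key : ∀ n, ∀ x ∈ closure (Q n), f x ∈ closure (E n) ∧
      ∃ v ∈ V n, f x ∈ v ∧ x ∈ closure (B n v) := by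
    intro n x hx
    have h1 : f x ∈ closure (E n) :=
      hf.closure_preimage_subset _ (closure_mono inter_subset_right hx)
    obtain ⟨v, hv, hxv⟩ := hG's n (hEcl n h1)
    refine ⟨h1, v, hv, hxv, ?_⟩
    have h2 : x ∈ closure (f ⁻¹' v ∩ Q n) :=
      (((hV n).1 v hv).preimage hf).inter_closure ⟨hxv, hx⟩
    refine closure_mono ?_ h2
    rintro z ⟨hz1, hz2, -⟩
    simp only [P, mem_iUnion] at hz2
    obtain ⟨w, hw, hz3, hz4⟩ := hz2
    rw [huniq n v hv w hw (f z) hz1 hz3]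
    exact hz4
  refine ⟨⋃ n, Q n, isOpen_iUnion fun n => (hPo n).inter ((hEo n).preimage hf), ?_, ?_, ?_⟩
  · refine eq_univ_of_forall fun y => ?_
    obtain ⟨n, hn⟩ := mem_iUnion.1 (hEc.ge (mem_univ y))
    obtain ⟨v, hv, hyv⟩ := hG's n (hEcl n (subset_closure hn))
    obtain ⟨x, hx, hxy⟩ := (hB n v hv).2.1 hyv
    subst hxy
    exact ⟨x, mem_iUnion.2 ⟨n, mem_biUnion hv ⟨hyv, hx⟩, hn⟩, rfl⟩
  · rw [hQlf.closure_iUnion]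
    refine iUnion_subset fun n x hx => ?_
    obtain ⟨-, v, hv, -, hxv⟩ := key n x hx
    exact (hB n v hv).2.2.1 hxv
  · intro y
    obtain ⟨M, hM⟩ := (hElf.closure.point_finite y).bddAbove
    refine ⟨M + 1, fun n => {x | ∃ v ∈ V n, y ∈ v ∧ x ∈ closure (B n v)}, ?_, ?_⟩
    · rintro n a ⟨v, hv, hyv, ha⟩ b ⟨w, hw, hyw, hb⟩
      rw [← huniq n v hv w hw y hyv hyw] at hb
      exact (hB n v hv).2.2.2 y hyv a ha b hb
    · intro x hx hxy
      rw [hQlf.closure_iUnion] at hx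
      obtain ⟨n, hn⟩ := mem_iUnion.1 hx
      obtain ⟨h1, h2⟩ := key n x hn
      rw [hxy] at h1 h2
      exact ⟨n, Nat.lt_succ_of_le (hM h1), h2⟩

theorem aux_small {X Y : Type*} [MetricSpace X] [TopologicalSpace Y] [T2Space Y]
    [ParacompactSpace Y] (hY : IsCSpace Y) (f : X → Y) (hf : Continuous f) (hopen : IsOpenMap f)
    (U : Set X) (hU : IsOpen U) (hUsec : f '' U = Set.univ) (ε : ℝ) (hε : 0 < ε) :
    ∃ G : Set X, IsOpen G ∧ f '' G = Set.univ ∧ closure G ⊆ U ∧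
      meshd f G ≤ ε ∧ tdd f G ≤ ENNReal.ofReal ε := by
  have hpos : ∀ n : ℕ, 0 < ε / 2 / 2 ^ n := fun n => by positivity
  obtain ⟨G, hGo, hGs, hGc, hG⟩ := aux_main hY f hf hopen U hU hUsec
    (fun n => ContinuousMap.const Y (ε / 2 / 2 ^ n)) (fun n y => hpos n)
  refine ⟨G, hGo, hGs, hGc, ?_, ?_⟩
  · refine Real.iSup_le (fun y => ?_) hε.le
    obtain ⟨M, D, hD, hcov⟩ := hG y
    refine csInf_le ⟨0, ?_⟩ (Or.inr ⟨hε, ?_⟩)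
    · rintro a (rfl | ⟨ha, -⟩)
      · exact zero_le_one
      · exact ha.le
    obtain ⟨x₀, hx₀, hx₀y⟩ := hGs.ge (mem_univ y)
    have hch : ∀ n, ∃ p : X, p ∈ f ⁻¹' {y} ∩ G ∧
        ((D n ∩ (f ⁻¹' {y} ∩ G)).Nonempty → p ∈ D n) := by
      intro n
      by_cases h : (D n ∩ (f ⁻¹' {y} ∩ G)).Nonempty
      · obtain ⟨p, hp1, hp2⟩ := h
        exact ⟨p, hp2, fun _ => hp1⟩
      · exact ⟨x₀, ⟨hx₀y, hx₀⟩, fun h' => absurd h' h⟩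
    choose p hp1 hp2 using hch
    classical
    refine ⟨insert x₀ ((Finset.range M).image p), ⟨x₀, by simp⟩, ?_, ?_⟩
    · intro z hz
      simp only [Finset.coe_insert, Finset.coe_image, mem_insert_iff, mem_image] at hz
      rcases hz with rfl | ⟨n, -, rfl⟩
      · exact ⟨hx₀y, hx₀⟩
      · exact hp1 n
    · rintro x hx
      obtain ⟨n, hn, hxn⟩ := hcov x (subset_closure hx.2) hx.1
      refine mem_biUnion (x := p n) ?_ ?_
      · exact Finset.mem_coe.2 (Finset.mem_insert_of_mem
          (Finset.mem_image_of_mem _ (Finset.mem_range.2 hn)))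
      · rw [Metric.mem_ball]
        refine (hD n x hxn (p n) (hp2 n ⟨x, hxn, hx⟩)).trans_lt ?_
        have h1 : ε / 2 / 2 ^ n ≤ ε / 2 :=
          div_le_self (by linarith) (one_le_pow₀ (by norm_num))
        simp only [ContinuousMap.const_apply]
        linarith
  · refine iSup_le fun y => iSup_le fun C => iSup_le fun hC => ?_
    obtain ⟨M, D, hD, hcov⟩ := hG y
    refine (aux_ediam C hC.2 D (fun n => ENNReal.ofReal (ε / 2 / 2 ^ n)) (fun n => ?_) ?_).trans ?_
    · refine Metric.ediam_le fun a ha b hb => ?_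
      rw [edist_dist]
      exact ENNReal.ofReal_le_ofReal (hD n a ha b hb)
    · intro x hx
      obtain ⟨n, -, hn⟩ := hcov x (subset_closure (hC.1 hx).2) (hC.1 hx).1
      exact mem_iUnion.2 ⟨n, hn⟩
    · rw [← ENNReal.ofReal_tsum_of_nonneg (fun n => (hpos n).le) (summable_geometric_two' ε),
        tsum_geometric_two']

theorem aux_split {X Y : Type*} [MetricSpace X] [TopologicalSpace Y] [T2Space Y]
    [ParacompactSpace Y] (hY : IsCSpace Y) (f : X → Y) (hf : Continuous f) (hopen : IsOpenMap f)
    (hdense : ∀ y : Y, ∀ x ∈ f ⁻¹' {y}, AccPt x (𝓟 (f ⁻¹' {y})))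
    (U : Set X) (hU : IsOpen U) (hUsec : f '' U = Set.univ) (ε : ℝ) (hε : 0 < ε) :
    ∃ G : Bool → Set X, (∀ b, IsOpen (G b) ∧ f '' (G b) = Set.univ ∧ closure (G b) ⊆ U ∧
      meshd f (G b) ≤ ε ∧ tdd f (G b) ≤ ENNReal.ofReal ε) ∧ Disjoint (G true) (G false) := by
  obtain ⟨r, hr, hP⟩ := aux_seq f hopen U hU hUsec hdense
  obtain ⟨G, hGo, hGs, hGc, hG⟩ := aux_main hY f hf hopen U hU hUsec r hr
  have hH : f '' (U \ closure G) = univ := by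
    refine eq_univ_of_forall fun y => ?_
    obtain ⟨M, D, hD, hcov⟩ := hG y
    obtain ⟨ι, hι, x, hx, hA⟩ := hP M y
    by_contra hcon
    have hin : ∀ i, ∃ n : Fin M, x i ∈ D n := by
      intro i
      have : x i ∈ closure G := by
        by_contra h
        exact hcon ⟨x i, ⟨(hx i).2, h⟩, (hx i).1⟩
      obtain ⟨n, hn, h⟩ := hcov _ this (hx i).1
      exact ⟨⟨n, hn⟩, h⟩
    choose c hc using hin
    obtain ⟨i, j, hij, hlt⟩ := hA c
    have h1 := hc j
    rw [← hij] at h1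
    exact absurd (hD _ _ (hc i) _ h1) (not_le.2 hlt)
  obtain ⟨G1, h1⟩ := aux_small hY f hf hopen G hGo hGs ε hε
  obtain ⟨G2, h2⟩ := aux_small hY f hf hopen (U \ closure G) (hU.sdiff isClosed_closure) hH ε hε
  refine ⟨fun b => if b then G1 else G2, ?_, ?_⟩
  · intro b
    cases b
    · exact ⟨h2.1, h2.2.1, h2.2.2.1.trans diff_subset, h2.2.2.2⟩
    · exact ⟨h1.1, h1.2.1, h1.2.2.1.trans (subset_closure.trans hGc), h1.2.2.2⟩
  · rw [Set.disjoint_left]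
    intro x hx1 hx2
    exact (h2.2.2.1 (subset_closure hx2)).2 (subset_closure (h1.2.2.1 (subset_closure hx1)))

/-- Finite binary sequences of positive length are modelled by nonempty `List Bool`;
`s <+: t` is the initial-segment (prefix) relation. -/
theorem statement12 {X Y : Type*} [MetricSpace X]
    [TopologicalSpace Y] [T2Space Y] [ParacompactSpace Y] (hY : IsCSpace Y)
    (f : X → Y) (hf : Continuous f) (hopen : IsOpenMap f) (hsurj : Function.Surjective f)
    (hdense : ∀ y : Y, ∀ x ∈ f ⁻¹' {y}, AccPt x (𝓟 (f ⁻¹' {y})))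
    (hcompl : ∀ y : Y, IsComplete (f ⁻¹' {y}))
    (U : Set X) (hU : IsOpen U) (hUsec : f '' U = Set.univ) :
    ∃ h : List Bool → Set X,
      (∀ t : List Bool, t ≠ [] → IsOpen (h t) ∧ f '' h t = Set.univ ∧ h t ⊆ U) ∧
      (∀ s t : List Bool, s ≠ [] → s ≠ t → s <+: t → closure (h t) ⊆ h s) ∧
      (∀ s t : List Bool, s ≠ [] → t ≠ [] → s ≠ t → ¬ s <+: t → ¬ t <+: s →
        h s ∩ h t = ∅) ∧
      (∀ (t : List Bool) (n : ℕ), t.length = n + 1 →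
        meshd f (h t) ≤ (2: ℝ)⁻¹ ^ n ∧ tdd f (h t) ≤ ENNReal.ofReal ((2: ℝ)⁻¹ ^ n)) := by
  choose S hS1 hS2 using fun (n : ℕ) (A : {A : Set X // IsOpen A ∧ f '' A = univ}) =>
    aux_split hY f hf hopen hdense A.1 A.2.1 A.2.2 ((2:ℝ)⁻¹ ^ n) (by positivity)
  let g : List Bool → {A : Set X // IsOpen A ∧ f '' A = univ} := fun l =>
    List.rec ⟨U, hU, hUsec⟩ (fun b l A => ⟨S l.length A b, (hS1 _ A b).1, (hS1 _ A b).2.1⟩) l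
  have hg : ∀ b l, (g (b :: l)).1 = S l.length (g l) b := fun b l => rfl
  have hcl : ∀ b l, closure (g (b :: l)).1 ⊆ (g l).1 := fun b l => (hS1 _ (g l) b).2.2.1
  -- nested, for suffixes
  have happ : ∀ u l, (g (u ++ l)).1 ⊆ (g l).1 := by
    intro u l
    induction u with
    | nil => exact subset_rfl
    | cons b u ih => exact subset_closure.trans ((hcl b (u ++ l)).trans ih)
  have happ' : ∀ u l, u ≠ [] → closure (g (u ++ l)).1 ⊆ (g l).1 := by
    intro u l hu
    cases u with
    | nil => exact absurd rfl hu
    | cons b u => exact (hcl b (u ++ l)).trans (happ u l)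
  have hdis : ∀ (b b' : Bool) l, b ≠ b' → Disjoint (g (b :: l)).1 (g (b' :: l)).1 := by
    intro b b' l hb
    have h := hS2 l.length (g l)
    rw [hg, hg]
    cases b <;> cases b'
    · exact absurd rfl hb
    · exact h.symm
    · exact h
    · exact absurd rfl hb
  -- incomparable sequences split at a first difference
  have hsplit : ∀ s t : List Bool, ¬ s <+: t → ¬ t <+: s → ∃ p b b' u v, b ≠ b' ∧
      s = p ++ b :: u ∧ t = p ++ b' :: v := by
    intro s
    induction s with
    | nil => intro t h; exact absurd (List.nil_prefix) h
    | cons a s ih =>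
      intro t h1 h2
      cases t with
      | nil => exact absurd (List.nil_prefix) h2
      | cons a' t =>
        by_cases ha : a = a'
        · subst ha
          rw [List.cons_prefix_cons] at h1 h2
          obtain ⟨p, b, b', u, v, hb, rfl, rfl⟩ := ih t (by simpa using h1) (by simpa using h2)
          exact ⟨a :: p, b, b', u, v, hb, rfl, rfl⟩
        · exact ⟨[], a, a', s, t, ha, rfl, rfl⟩
  refine ⟨fun t => (g t.reverse).1, ?_, ?_, ?_, ?_⟩
  · intro t _
    refine ⟨(g t.reverse).2.1, (g t.reverse).2.2, ?_⟩
    have := happ t.reverse []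
    rwa [List.append_nil] at this
  · rintro s t - hst ⟨u, rfl⟩
    beta_reduce
    rw [List.reverse_append]
    apply happ'
    rintro h
    apply hst
    simp [List.reverse_eq_nil_iff.1 h]
  · intro s t _ _ _ h1 h2
    obtain ⟨p, b, b', u, v, hb, rfl, rfl⟩ := hsplit s t h1 h2
    have e : ∀ (c : Bool) w, (p ++ c :: w).reverse = w.reverse ++ (c :: p.reverse) := by
      intro c w; simp
    beta_reduce
    rw [e, e, ← Set.disjoint_iff_inter_eq_empty]
    exact (hdis b b' p.reverse hb).mono (happ _ _) (happ _ _)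
  · intro t n ht
    beta_reduce
    have hl : t.reverse.length = n + 1 := by simpa using ht
    match h : t.reverse, hl with
    | b :: l, hl =>
      have hl' : l.length = n := by simpa using hl
      rw [hg, ← hl']
      exact (hS1 _ (g l) b).2.2.2
end

section
/- Let (X,d) be a metric space, Y a paracompact Hausdorff C-space, f : X → Y an open continuous surjection such that each fiber f⁻¹(y) is dense in itself (has no isolated points) and d-complete, and U an open section for f. Then there exist a closed section H ⊂ X for f with H ⊂ U and a surjective compact light continuous map ℓ : H → Y × 𝔠, where 𝔠 is the Cantor space 2^ω, such that f↾H = P_Y ∘ ℓ, where P_Y : Y × 𝔠 → Y is the projection. In particular, f↾H is also a compact light map. -/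
open Set Topology Filter

/-- A space has covering dimension zero: every finite open cover admits a finite
refinement by pairwise disjoint open sets covering the space. -/
def CovDimZero (Z : Type*) [TopologicalSpace Z] : Prop :=
  ∀ 𝒰 : Finset (Set Z), (∀ U ∈ 𝒰, IsOpen U) → ⋃₀ (𝒰 : Set (Set Z)) = Set.univ →
    ∃ 𝒱 : Finset (Set Z), (∀ V ∈ 𝒱, IsOpen V) ∧ Set.Pairwise {V : Set Z | V ∈ 𝒱} Disjoint ∧
      (∀ V ∈ 𝒱, ∃ U ∈ 𝒰, V ⊆ U) ∧ ⋃₀ (𝒱 : Set (Set Z)) = Set.univ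


theorem covDimZero_of_profinite {Z : Type*} [TopologicalSpace Z] [CompactSpace Z] [T2Space Z]
    [TotallyDisconnectedSpace Z] : CovDimZero Z := by
  classical
  intro 𝒰 hop hcov
  have h : ∀ z : Z, ∃ V : Set Z, IsClopen V ∧ z ∈ V ∧ ∃ U ∈ 𝒰, V ⊆ U := by
    intro z
    have hz : z ∈ ⋃₀ (𝒰 : Set (Set Z)) := hcov ▸ mem_univ z
    obtain ⟨U, hU, hzU⟩ := hz
    obtain ⟨V, h1, h2, h3⟩ := compact_exists_isClopen_in_isOpen (hop U hU) hzU
    exact ⟨V, h1, h2, U, hU, h3⟩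
  choose V hV hzV hVU using h
  obtain ⟨t, ht⟩ := isCompact_univ.elim_finite_subcover V (fun z => (hV z).isOpen)
    (fun z _ => mem_iUnion.2 ⟨z, hzV z⟩)
  obtain ⟨C, hC1, -, hC3, hC4, hC5⟩ := exists_clopen_partition_of_clopen_cover
    (I := t) (Z := fun _ => (∅ : Set Z)) (D := fun i => V i) (fun _ => isClosed_empty)
    (fun i => hV i) (fun _ => empty_subset _) (fun _ _ _ _ _ => by simp [Function.onFun])
  refine ⟨Finset.univ.image C, ?_, ?_, ?_, ?_⟩
  · intro W hW
    simp only [Finset.mem_image] at hW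
    obtain ⟨i, -, rfl⟩ := hW
    exact (hC1 i).isOpen
  · intro A hA B hB hAB
    simp only [Finset.mem_image, mem_ofPred_eq, Finset.mem_univ, true_and] at hA hB
    obtain ⟨i, rfl⟩ := hA
    obtain ⟨j, rfl⟩ := hB
    exact hC5 (mem_univ i) (mem_univ j) (fun h => hAB (by rw [h]))
  · intro W hW
    simp only [Finset.mem_image] at hW
    obtain ⟨i, -, rfl⟩ := hW
    obtain ⟨U, hU, h⟩ := hVU i
    exact ⟨U, hU, (hC3 i).trans h⟩
  · refine eq_univ_of_forall fun z => ?_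
    have hz := ht (mem_univ z)
    simp only [mem_iUnion] at hz
    obtain ⟨i, hi, hz⟩ := hz
    obtain ⟨j, hj⟩ := mem_iUnion.1 (hC4 (mem_iUnion.2 ⟨⟨i, hi⟩, hz⟩))
    exact ⟨C j, by simp, hj⟩

/-- A locally finite open refinement with closures inside the original sets. -/
theorem precise_refinement_closure {Y ι : Type*} [TopologicalSpace Y] [T2Space Y]
    [ParacompactSpace Y] (u : ι → Set Y) (uo : ∀ i, IsOpen (u i)) (uc : ⋃ i, u i = univ) :
    ∃ v : ι → Set Y, (∀ i, IsOpen (v i)) ∧ ⋃ i, v i = univ ∧ LocallyFinite v ∧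
      ∀ i, closure (v i) ⊆ u i := by
  obtain ⟨v, h1, h2, h3, h4⟩ := precise_refinement u uo uc
  obtain ⟨w, g1, g2, g3⟩ := exists_iUnion_eq_closure_subset h1 (fun x => h3.point_finite x) h2
  exact ⟨w, g2, g1, h3.subset (fun i => subset_closure.trans (g3 i)),
    fun i => (g3 i).trans (h4 i)⟩

/-- Linear independence on finitely many points of the fiber. -/
def FibInd {X Y : Type*} [TopologicalSpace X] (f : X → Y) (z : Y) {n : ℕ}
    (b : Fin n → C(X, ℝ)) : Prop :=
  ∃ (ι : Type) (_ : Fintype ι) (p : ι → X), (∀ l, f (p l) = z) ∧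
    LinearIndependent ℝ (fun k (l : ι) => b k (p l))

theorem FibInd.eventually {X Y : Type*} [TopologicalSpace X] [TopologicalSpace Y] {f : X → Y}
    (hopen : IsOpenMap f) {z : Y} {n : ℕ} {b : Fin n → C(X, ℝ)} (h : FibInd f z b) :
    ∀ᶠ z' in 𝓝 z, FibInd f z' b := by
  obtain ⟨ι, hι, p, hp, hli⟩ := h
  have hcont : Continuous (fun (q : ι → X) (k : Fin n) (l : ι) => b k (q l)) := by fun_prop
  have hev := (hcont.tendsto p).eventually hli.eventually
  rw [nhds_pi, Filter.eventually_iff, Filter.mem_pi'] at hev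
  obtain ⟨I, t, ht, hsub⟩ := hev
  have h1 : ∀ᶠ z' in 𝓝 z, ∀ l, z' ∈ f '' t l := by
    rw [Filter.eventually_all]
    intro l
    have := hopen.image_mem_nhds (ht l)
    rwa [hp l] at this
  filter_upwards [h1] with z' hz'
  choose q hq hqz using hz'
  exact ⟨ι, hι, q, hqz, hsub (fun l _ => hq l)⟩

theorem exists_interp {X : Type*} [MetricSpace X] (s : Finset X) (w : s → ℝ) :
    ∃ h : C(X, ℝ), ∀ x : s, h x = w x := by
  obtain ⟨g, hg⟩ := ContinuousMap.exists_extension'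
    (s.finite_toSet.isClosed.isClosedEmbedding_subtypeVal) (⟨w, continuous_of_discreteTopology⟩ : C(s, ℝ))
  exact ⟨g, fun x => congrFun hg x⟩

theorem exists_extend {X Y : Type*} [MetricSpace X] {f : X → Y} {z : Y}
    (hinf : (f ⁻¹' {z}).Infinite) {n : ℕ} (T : Set (Fin n → C(X, ℝ))) (hT : T.Finite)
    (hind : ∀ b ∈ T, FibInd f z b) :
    ∃ h : C(X, ℝ), ∀ b ∈ T, FibInd f z (Fin.cons h b : Fin (n + 1) → C(X, ℝ)) := by
  classical
  obtain ⟨s, hs, hcard⟩ := hinf.exists_subset_card_eq (n + 1)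
  let sp : (Fin n → C(X, ℝ)) → Submodule ℝ (s → ℝ) := fun b =>
    Submodule.span ℝ (range fun k (l : s) => b k l)
  have hne : ∀ b, sp b ≠ ⊤ := by
    intro b hb
    have h1 : Module.finrank ℝ (sp b) ≤ Fintype.card (Fin n) := by
      have := finrank_range_le_card (R := ℝ) (M := s → ℝ)
        (b := (fun (k : Fin n) (l : s) => b k (l : X)))
      exact this
    rw [hb, finrank_top, Module.finrank_fintype_fun_eq_card] at h1
    simp [hcard] at h1
  have hun := Subspace.biUnion_ne_univ_of_top_notMem (k := ℝ) (E := s → ℝ)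
    (s := hT.toFinset.image sp) (by
      intro h
      simp only [Finset.mem_image] at h
      obtain ⟨b, -, hb⟩ := h
      exact hne b hb)
  obtain ⟨w, hw⟩ := (ne_univ_iff_exists_notMem _).1 hun
  obtain ⟨h, hh⟩ := exists_interp s w
  refine ⟨h, fun b hb => ?_⟩
  have hwb : w ∉ sp b := fun hwb => hw (mem_biUnion (Finset.mem_image_of_mem _ (hT.mem_toFinset.2 hb)) hwb)
  obtain ⟨ι, hι, p, hp, hli⟩ := hind b hb
  let e := s.equivFin
  let q : Fin s.card → X := fun k => (e.symm k : X)
  refine ⟨ι ⊕ Fin s.card, inferInstance, Sum.elim p q, ?_, ?_⟩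
  · rintro (l | l)
    · exact hp l
    · exact hs (e.symm l).2
  · have : (fun k (l : ι ⊕ Fin s.card) => (Fin.cons h b : Fin (n + 1) → C(X, ℝ)) k (Sum.elim p q l))
        = Fin.cons (fun l => h (Sum.elim p q l)) (fun k l => b k (Sum.elim p q l)) := by
      funext k
      refine Fin.cases ?_ (fun k => ?_) k <;> rfl
    rw [this, linearIndependent_finCons]
    constructor
    · exact LinearIndependent.of_comp (LinearMap.funLeft ℝ ℝ (Sum.inl : ι → ι ⊕ Fin s.card)) hli
    · intro hmem
      apply hwb
      have := Submodule.mem_map_of_mem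
        (f := LinearMap.funLeft ℝ ℝ (fun l : s => (Sum.inr (e l) : ι ⊕ Fin s.card))) hmem
      rw [Submodule.map_span, ← range_comp] at this
      convert this using 1
      · simp only [sp]
        congr 2
        funext k l
        simp [LinearMap.funLeft, q]
      · funext l
        simp [LinearMap.funLeft, q, hh]

/-- The inductive state: a finite-valued, upper semicontinuous assignment of fiberwise
independent tuples of functions. -/
structure GoodTuples {X Y : Type*} [TopologicalSpace X] [TopologicalSpace Y] (f : X → Y) (n : ℕ)
    (Θ : Y → Set (Fin n → C(X, ℝ))) : Prop where
  fin : ∀ z, (Θ z).Finite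
  usc : ∀ z, ∀ᶠ z' in 𝓝 z, Θ z' ⊆ Θ z
  ind : ∀ z, ∀ b ∈ Θ z, FibInd f z b

/-- Extending the tuples by functions attached to the cover `W`. -/
def nextTuples {X Y : Type*} [TopologicalSpace X] [TopologicalSpace Y] {n : ℕ}
    (W : Y → Set Y) (g : Y → C(X, ℝ)) (Θ : Y → Set (Fin n → C(X, ℝ))) :
    Y → Set (Fin (n + 1) → C(X, ℝ)) :=
  fun z => {c | ∃ i, z ∈ closure (W i) ∧ ∃ b ∈ Θ z, c = Fin.cons (g i) b}

theorem GoodTuples.step {X Y : Type*} [MetricSpace X] [TopologicalSpace Y] [T2Space Y]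
    [ParacompactSpace Y] {f : X → Y} (hopen : IsOpenMap f)
    (hinf : ∀ z, (f ⁻¹' {z}).Infinite) {n : ℕ} {Θ : Y → Set (Fin n → C(X, ℝ))}
    (h : GoodTuples f n Θ) :
    ∃ (W : Y → Set Y) (g : Y → C(X, ℝ)), (∀ i, IsOpen (W i)) ∧ (⋃ i, W i = univ) ∧
      GoodTuples f (n + 1) (nextTuples W g Θ) := by
  choose g hg using fun z => exists_extend (hinf z) (Θ z) (h.fin z) (h.ind z)
  have hN : ∀ z, ∃ N : Set Y, IsOpen N ∧ z ∈ N ∧ ∀ z' ∈ N, ∀ b ∈ Θ z',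
      FibInd f z' (Fin.cons (g z) b : Fin (n + 1) → C(X, ℝ)) := by
    intro z
    have h1 : ∀ᶠ z' in 𝓝 z, ∀ b ∈ Θ z, FibInd f z' (Fin.cons (g z) b : Fin (n + 1) → C(X, ℝ)) := by
      rw [Filter.eventually_all_finite (h.fin z)]
      intro b hb
      exact (hg z b hb).eventually hopen
    obtain ⟨N, hN, hNo, hz⟩ := eventually_nhds_iff.1 (h1.and (h.usc z))
    exact ⟨N, hNo, hz, fun z' hz' b hb => (hN z' hz').1 b ((hN z' hz').2 hb)⟩
  choose N hNo hzN hN using hN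
  obtain ⟨W, hWo, hWc, hWl, hWN⟩ := precise_refinement_closure N hNo
    (eq_univ_of_forall fun z => mem_iUnion.2 ⟨z, hzN z⟩)
  have hcl := hWl.closure
  refine ⟨W, g, hWo, hWc, ?_, ?_, ?_⟩
  · intro z
    have := (hcl.point_finite z).image2 (fun i (b : Fin n → C(X, ℝ)) =>
      (Fin.cons (g i) b : Fin (n + 1) → C(X, ℝ))) (h.fin z)
    refine this.subset ?_
    rintro c ⟨i, hi, b, hb, rfl⟩
    exact ⟨i, hi, b, hb, rfl⟩
  · intro z
    have h1 := hcl.iInter_compl_mem_nhds (fun i => isClosed_closure) z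
    filter_upwards [h1, h.usc z] with z' hz' hz''
    rintro c ⟨i, hi, b, hb, rfl⟩
    refine ⟨i, ?_, b, hz'' hb, rfl⟩
    by_contra hcon
    simp only [mem_iInter] at hz'
    exact hz' i hcon hi
  · rintro z c ⟨i, hi, b, hb, rfl⟩
    exact hN i z (hWN i hi) b hb

theorem GoodTuples.zero {X Y : Type*} [TopologicalSpace X] [TopologicalSpace Y] {f : X → Y}
    (hsurj : Function.Surjective f) :
    GoodTuples f 1 (fun _ => {fun _ => (1 : C(X, ℝ))}) := by
  refine ⟨fun z => finite_singleton _, fun z => Eventually.of_forall fun _ => Subset.rfl, ?_⟩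
  rintro z b rfl
  obtain ⟨x, hx⟩ := hsurj z
  refine ⟨Unit, inferInstance, fun _ => x, fun _ => hx, ?_⟩
  rw [linearIndependent_unique_iff]
  intro h
  have := congrFun h ()
  simp at this

/-- The tuple `(g_{n-1}, ..., g_0, 1)`. -/
noncomputable def tup {X : Type*} [TopologicalSpace X] (t : ℕ → C(X, ℝ)) : (n : ℕ) → Fin (n + 1) → C(X, ℝ)
  | 0 => fun _ => 1
  | n + 1 => Fin.cons (t n) (tup t n)

def tupCoef (c : ℕ → ℝ) (a : ℝ) : (n : ℕ) → Fin (n + 1) → ℝ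
  | 0 => fun _ => a
  | n + 1 => Fin.cons (c n) (tupCoef c a n)

theorem tup_sum {X : Type*} [TopologicalSpace X] (t : ℕ → C(X, ℝ)) (c : ℕ → ℝ) (a : ℝ) (x : X)
    (n : ℕ) : ∑ k, tupCoef c a n k * tup t n k x = a + ∑ k ∈ Finset.range n, c k * t k x := by
  induction n with
  | zero => simp [tupCoef, tup]
  | succ n ih =>
    rw [Fin.sum_univ_succ, Finset.sum_range_succ]
    simp only [tupCoef, tup, Fin.cons_zero, Fin.cons_succ]
    rw [ih]; ring

theorem tupCoef_zero (c : ℕ → ℝ) (a : ℝ) (n : ℕ) (h : ∀ k, tupCoef c a n k = 0) :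
    ∀ k < n, c k = 0 := by
  induction n with
  | zero => simp
  | succ n ih =>
    intro k hk
    rcases Nat.lt_succ_iff_lt_or_eq.1 hk with h1 | rfl
    · exact ih (fun k => by simpa [tupCoef] using h k.succ) k h1
    · simpa [tupCoef] using h 0

theorem FibInd.nonconst {X Y : Type*} [TopologicalSpace X] {f : X → Y} {z : Y}
    {t : ℕ → C(X, ℝ)} {n : ℕ} (h : FibInd f z (tup t n)) (c : ℕ → ℝ) (a : ℝ)
    (hc : ∀ x, f x = z → ∑ k ∈ Finset.range n, c k * t k x = a) : ∀ k < n, c k = 0 := by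
  obtain ⟨ι, _, p, hp, hli⟩ := h
  refine tupCoef_zero c (-a) n ?_
  rw [Fintype.linearIndependent_iff] at hli
  refine hli _ ?_
  funext l
  have := tup_sum t c (-a) (p l) n
  rw [hc _ (hp l)] at this
  simpa using this

theorem exists_levels {X Y : Type*} [MetricSpace X] [TopologicalSpace Y] [T2Space Y]
    [ParacompactSpace Y] {f : X → Y} (hopen : IsOpenMap f) (hsurj : Function.Surjective f)
    (hinf : ∀ z, (f ⁻¹' {z}).Infinite) :
    ∃ (W : ℕ → Y → Set Y) (g : ℕ → Y → C(X, ℝ)), (∀ n i, IsOpen (W n i)) ∧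
      (∀ n, ⋃ i, W n i = univ) ∧
      ∀ z (i : ℕ → Y), (∀ n, z ∈ W n (i n)) → ∀ n, FibInd f z (tup (fun k => g k (i k)) n) := by
  have hstep : ∀ n (S : {Θ : Y → Set (Fin (n + 1) → C(X, ℝ)) // GoodTuples f (n + 1) Θ}),
      ∃ (W : Y → Set Y) (g : Y → C(X, ℝ)), (∀ i, IsOpen (W i)) ∧ (⋃ i, W i = univ) ∧
      GoodTuples f (n + 1 + 1) (nextTuples W g S.1) := fun n S => S.2.step hopen hinf
  choose W g hWo hWc hgood using hstep
  let S : ∀ n, {Θ : Y → Set (Fin (n + 1) → C(X, ℝ)) // GoodTuples f (n + 1) Θ} := fun n =>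
    Nat.rec ⟨_, GoodTuples.zero hsurj⟩ (fun n S => ⟨_, hgood n S⟩) n
  refine ⟨fun n => W n (S n), fun n => g n (S n), fun n => hWo n (S n), fun n => hWc n (S n), ?_⟩
  intro z i hi n
  refine (S n).2.ind z _ ?_
  induction n with
  | zero => exact rfl
  | succ n ih => exact ⟨i n, subset_closure (hi n), _, ih, rfl⟩

theorem exists_nonconst {X Y : Type*} [MetricSpace X] [TopologicalSpace Y] [T2Space Y]
    [ParacompactSpace Y] (hY : IsCSpace Y) {f : X → Y} (hf : Continuous f) (hopen : IsOpenMap f)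
    (hsurj : Function.Surjective f) (hinf : ∀ z, (f ⁻¹' {z}).Infinite) :
    ∃ G : C(X, ℝ), ∀ z, ∃ x x', f x = z ∧ f x' = z ∧ G x < G x' := by
  classical
  rcases isEmpty_or_nonempty Y with hE | ⟨⟨y₀⟩⟩
  · exact ⟨0, fun z => hE.elim z⟩
  obtain ⟨W, g, hWo, hWc, hind⟩ := exists_levels hopen hsurj hinf
  obtain ⟨V, hV, hVc⟩ := hY (fun n => range (W n)) (fun n => ⟨by
    rintro _ ⟨i, rfl⟩; exact hWo n i, by rw [sUnion_range, hWc n]⟩)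
  have hch : ∀ n (A : Set Y), ∃ i, A ∈ V n → A ⊆ W n i := by
    intro n A
    by_cases hA : A ∈ V n
    · obtain ⟨_, ⟨i, rfl⟩, h⟩ := (hV n).2.2 A hA
      exact ⟨i, fun _ => h⟩
    · exact ⟨y₀, fun h => absurd h hA⟩
  choose ix hix using hch
  let O : ℕ × Y → Set Y := fun p => ⋃₀ {A | A ∈ V p.1 ∧ ix p.1 A = p.2}
  have hOo : ∀ p, IsOpen (O p) := fun p => isOpen_sUnion fun A hA => (hV p.1).1 A hA.1
  have hOW : ∀ n j, O (n, j) ⊆ W n j := by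
    rintro n j z ⟨A, ⟨hA, hj⟩, hz⟩
    simp only at hA hj
    subst hj
    exact hix n A hA hz
  have hOd : ∀ n j j' z, z ∈ O (n, j) → z ∈ O (n, j') → j = j' := by
    rintro n j j' z ⟨A, ⟨hA, hj⟩, hz⟩ ⟨B, ⟨hB, hj'⟩, hz'⟩
    simp only at hA hj hB hj'
    subst hj hj'
    by_cases hAB : A = B
    · rw [hAB]
    · exact absurd hz' (disjoint_left.1 ((hV n).2.1 hA hB hAB) hz)
  have hOc : univ ⊆ ⋃ p, O p := by
    intro z _
    have : z ∈ ⋃₀ (⋃ n, V n) := hVc ▸ mem_univ z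
    obtain ⟨A, hA, hz⟩ := this
    obtain ⟨n, hA⟩ := mem_iUnion.1 hA
    exact mem_iUnion.2 ⟨(n, ix n A), A, ⟨hA, rfl⟩, hz⟩
  obtain ⟨ρ, hρ⟩ := PartitionOfUnity.exists_isSubordinate isClosed_univ O hOo hOc
  let G : C(X, ℝ) := ⟨fun x => ∑ᶠ p : ℕ × Y, ρ p (f x) * g p.1 p.2 x, by
    refine continuous_finsum (fun p => by fun_prop) ?_
    refine (ρ.locallyFinite.preimage_continuous hf).subset ?_
    intro p x hx
    simp only [Function.mem_support] at hx
    exact left_ne_zero_of_mul hx⟩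
  refine ⟨G, fun z => ?_⟩
  by_contra hcon
  push Not at hcon
  obtain ⟨x₀, hx₀⟩ := hsurj z
  have hconst : ∀ x, f x = z → G x = G x₀ := fun x hx =>
    le_antisymm (hcon x₀ x hx₀ hx) (hcon x x₀ hx hx₀)
  -- indices at `z`
  have hi : ∀ n, ∃ i, z ∈ W n i ∧ ∀ j, z ∈ O (n, j) → j = i := by
    intro n
    by_cases h : ∃ j, z ∈ O (n, j)
    · obtain ⟨j, hj⟩ := h
      exact ⟨j, hOW n j hj, fun j' hj' => hOd n _ _ z hj' hj⟩
    · obtain ⟨i, hi⟩ := mem_iUnion.1 ((hWc n).symm ▸ mem_univ z : z ∈ ⋃ i, W n i)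
      exact ⟨i, hi, fun j hj => absurd ⟨j, hj⟩ h⟩
  choose i hiW hiO using hi
  have hsupp : ∀ p : ℕ × Y, ρ p z ≠ 0 → p.2 = i p.1 := by
    rintro ⟨n, j⟩ hp
    exact hiO n j (hρ _ (subset_closure hp))
  have hfin : {p : ℕ × Y | ρ p z ≠ 0}.Finite := ρ.locallyFinite.point_finite z
  obtain ⟨N, hN⟩ : ∃ N, ∀ p : ℕ × Y, ρ p z ≠ 0 → p.1 < N := by
    obtain ⟨N, hN⟩ := (hfin.image Prod.fst).bddAbove
    exact ⟨N + 1, fun p hp => Nat.lt_succ_of_le (hN ⟨p, hp, rfl⟩)⟩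
  have hsum : ∀ u : ℕ × Y → ℝ, ∑ᶠ p, ρ p z * u p =
      ∑ k ∈ Finset.range N, ρ (k, i k) z * u (k, i k) := by
    intro u
    have hinj : Function.Injective (fun k => (k, i k)) := fun a b hab => (Prod.ext_iff.1 hab).1
    refine Eq.trans ?_
      (Finset.sum_map (Finset.range N) ⟨fun k => (k, i k), hinj⟩ (fun p => ρ p z * u p))
    refine finsum_eq_sum_of_support_subset _ ?_
    intro p hp
    have hp' : ρ p z ≠ 0 := left_ne_zero_of_mul hp
    simp only [Finset.coe_map, Function.Embedding.coeFn_mk, Finset.coe_range, mem_image, mem_Iio]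
    exact ⟨p.1, hN p hp', Prod.ext rfl (hsupp p hp').symm⟩
  have hzero := (hind z i hiW N).nonconst (fun k => ρ (k, i k) z) (G x₀) (by
    intro x hx
    rw [← hconst x hx, ← hsum (fun p => g p.1 p.2 x)]
    simp only [G, ContinuousMap.coe_mk, hx])
  have h1 := ρ.sum_eq_one (mem_univ z)
  have h2 := hsum (fun _ => 1)
  simp only [mul_one] at h2
  rw [h1, Finset.sum_eq_zero (fun k hk => hzero k (Finset.mem_range.1 hk))] at h2
  exact one_ne_zero h2

/-- Open sections. -/
def OSec {X Y : Type*} [TopologicalSpace X] (f : X → Y) (U : Set X) : Prop :=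
  IsOpen U ∧ ∀ y, ∃ x ∈ U, f x = y

theorem exists_split {X Y : Type*} [MetricSpace X] [TopologicalSpace Y] [T2Space Y]
    [ParacompactSpace Y] (hY : IsCSpace Y) {f : X → Y} (hf : Continuous f) (hopen : IsOpenMap f)
    (hdense : ∀ y : Y, ∀ x ∈ f ⁻¹' {y}, AccPt x (𝓟 (f ⁻¹' {y})))
    {U : Set X} (hU : OSec f U) :
    ∃ A B : Set X, OSec f A ∧ OSec f B ∧ A ⊆ U ∧ B ⊆ U ∧ Disjoint A B := by
  let fU : U → Y := fun x => f x
  have hfU : Continuous fU := hf.comp continuous_subtype_val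
  have hoU : IsOpenMap fU := hopen.comp hU.1.isOpenMap_subtype_val
  have hsU : Function.Surjective fU := fun y => by
    obtain ⟨x, hx, hxy⟩ := hU.2 y
    exact ⟨⟨x, hx⟩, hxy⟩
  have hinf : ∀ z, (fU ⁻¹' {z}).Infinite := by
    intro z hfin
    obtain ⟨x, hx, hxz⟩ := hU.2 z
    have hF := (hfin.image Subtype.val).subset (sdiff_subset (t := {x}))
    have hmem : U ∩ (Subtype.val '' (fU ⁻¹' {z}) \ {x})ᶜ ∈ 𝓝 x :=
      Filter.inter_mem (hU.1.mem_nhds hx) (hF.isClosed.isOpen_compl.mem_nhds (by simp))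
    obtain ⟨y, ⟨⟨hy1, hy2⟩, hy3⟩, hyx⟩ := accPt_iff_nhds.1 (hdense z x hxz) _ hmem
    exact hy2 ⟨⟨⟨y, hy1⟩, hy3, rfl⟩, hyx⟩
  obtain ⟨G, hG⟩ := exists_nonconst hY hfU hoU hsU hinf
  obtain ⟨h, hh⟩ := exists_continuous_forall_mem_convex_of_local_const (E := ℝ)
    (t := fun y => {c : ℝ | (∃ x, fU x = y ∧ G x < c) ∧ ∃ x, fU x = y ∧ c < G x}) (by
      intro y
      apply Set.OrdConnected.convex
      refine ⟨?_⟩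
      rintro a ⟨⟨x, hx, hxa⟩, -⟩ b ⟨-, ⟨x', hx', hxb⟩⟩ c ⟨hac, hcb⟩
      exact ⟨⟨x, hx, hxa.trans_le hac⟩, ⟨x', hx', hcb.trans_lt hxb⟩⟩) (by
      intro y
      obtain ⟨x, x', hx, hx', hlt⟩ := hG y
      obtain ⟨c, hc1, hc2⟩ := exists_between hlt
      refine ⟨c, ?_⟩
      have h1 : fU '' {u | G u < c} ∈ 𝓝 y := hx ▸ hoU.image_mem_nhds
        ((isOpen_lt G.continuous continuous_const).mem_nhds hc1)
      have h2 : fU '' {u | c < G u} ∈ 𝓝 y := hx' ▸ hoU.image_mem_nhds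
        ((isOpen_lt continuous_const G.continuous).mem_nhds hc2)
      filter_upwards [h1, h2] with y' ha hb
      obtain ⟨u, hu, hu'⟩ := ha
      obtain ⟨v, hv, hv'⟩ := hb
      exact ⟨⟨u, hu', hu⟩, ⟨v, hv', hv⟩⟩)
  have hcomp : Continuous fun x => h (fU x) := h.continuous.comp hfU
  refine ⟨Subtype.val '' {x | G x < h (fU x)}, Subtype.val '' {x | h (fU x) < G x},
    ⟨hU.1.isOpenMap_subtype_val _ (isOpen_lt G.continuous hcomp), ?_⟩,
    ⟨hU.1.isOpenMap_subtype_val _ (isOpen_lt hcomp G.continuous), ?_⟩, ?_, ?_, ?_⟩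
  · intro y
    obtain ⟨⟨x, hx, hlt⟩, -⟩ := hh y
    exact ⟨x, ⟨x, by simpa [hx] using hlt, rfl⟩, hx⟩
  · intro y
    obtain ⟨-, ⟨x, hx, hlt⟩⟩ := hh y
    exact ⟨x, ⟨x, by simpa [hx] using hlt, rfl⟩, hx⟩
  · rintro _ ⟨x, -, rfl⟩; exact x.2
  · rintro _ ⟨x, -, rfl⟩; exact x.2
  · rw [disjoint_left]
    rintro _ ⟨x, hx, rfl⟩ ⟨x', hx', he⟩
    obtain rfl := Subtype.ext he
    simp only [mem_ofPred_eq] at hx hx'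
    exact lt_asymm hx hx'

theorem exists_seq {X Y : Type*} [MetricSpace X] [TopologicalSpace Y] [T2Space Y]
    [ParacompactSpace Y] (hY : IsCSpace Y) {f : X → Y} (hf : Continuous f) (hopen : IsOpenMap f)
    (hdense : ∀ y : Y, ∀ x ∈ f ⁻¹' {y}, AccPt x (𝓟 (f ⁻¹' {y})))
    {U : Set X} (hU : OSec f U) :
    ∃ S : ℕ → Set X, (∀ n, OSec f (S n)) ∧ (∀ n, S n ⊆ U) ∧ ∀ m n, m ≠ n → Disjoint (S m) (S n) := by
  choose A B hA hB hAU hBU hd using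
    fun R : {U : Set X // OSec f U} => exists_split hY hf hopen hdense R.2
  let R : ℕ → {U : Set X // OSec f U} := fun n => Nat.rec ⟨U, hU⟩ (fun _ R => ⟨B R, hB R⟩) n
  have hRs : ∀ n, (R (n + 1)).1 = B (R n) := fun n => rfl
  have hanti : Antitone fun n => (R n).1 := antitone_nat_of_succ_le fun n => hBU (R n)
  have key : ∀ m n, m < n → Disjoint (A (R m)) (A (R n)) := by
    intro m n hmn
    have h1 : (R n).1 ⊆ B (R m) := hanti (Nat.succ_le_of_lt hmn)
    exact (hd (R m)).mono_right ((hAU (R n)).trans h1)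
  refine ⟨fun n => A (R n), fun n => hA _, fun n => (hAU _).trans (hanti (Nat.zero_le n)), ?_⟩
  intro m n hmn
  rcases lt_or_gt_of_ne hmn with h | h
  · exact key m n h
  · exact (key n m h).symm

theorem exists_step {X Y : Type*} [MetricSpace X] [TopologicalSpace Y] [T2Space Y]
    [ParacompactSpace Y] (hY : IsCSpace Y) {f : X → Y} (hf : Continuous f) (hopen : IsOpenMap f)
    (hdense : ∀ y : Y, ∀ x ∈ f ⁻¹' {y}, AccPt x (𝓟 (f ⁻¹' {y})))
    {U : Set X} (hU : OSec f U) {ε : ℝ} (hε : 0 < ε) :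
    ∃ V : Bool → Set X, (∀ b, OSec f (V b)) ∧ (∀ b, closure (V b) ⊆ U) ∧
      (Disjoint (closure (V true)) (closure (V false))) ∧
      ∀ b y, ∃ 𝓕 : Set (Set X), 𝓕.Finite ∧ (∀ F ∈ 𝓕, IsClosed F) ∧ 𝓕.PairwiseDisjoint id ∧
        (∀ F ∈ 𝓕, ∀ x ∈ F, ∀ x' ∈ F, dist x x' ≤ ε) ∧
        closure (V b) ∩ f ⁻¹' {y} ⊆ ⋃₀ 𝓕 := by
  obtain ⟨S, hS, hSU, hSd⟩ := exists_seq hY hf hopen hdense hU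
  let T : ℕ → Bool → Set X := fun n b => S (2 * n + b.toNat)
  have hT : ∀ n b, OSec f (T n b) := fun n b => hS _
  have hTd : ∀ n b m b', (n ≠ m ∨ b ≠ b') → Disjoint (T n b) (T m b') := by
    intro n b m b' h
    apply hSd
    cases b <;> cases b' <;> simp at h ⊢ <;> omega
  -- the admissible sets
  let D : ℕ → Set Y → (Bool → X) → ℝ → Prop := fun n N c r => 0 < r ∧ 2 * r ≤ ε ∧
    ∀ b, Metric.closedBall (c b) r ⊆ T n b ∧ N ⊆ f '' Metric.ball (c b) r
  obtain ⟨V, hV, hVc⟩ := hY (fun n => {N | IsOpen N ∧ ∃ c r, D n N c r}) (by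
    intro n
    refine ⟨fun N hN => hN.1, eq_univ_of_forall fun y => ?_⟩
    choose c hc hcy using fun b => (hT n b).2 y
    have : ∀ b, ∃ r > 0, Metric.closedBall (c b) r ⊆ T n b := fun b =>
      Metric.nhds_basis_closedBall.mem_iff.1 ((hT n b).1.mem_nhds (hc b))
    choose r hr hrT using this
    let r' := min (ε / 2) (min (r true) (r false))
    have hr' : 0 < r' := by simp [r', hε, hr]
    refine ⟨⋂ b, f '' Metric.ball (c b) r', ⟨isOpen_iInter_of_finite fun b =>
      hopen _ Metric.isOpen_ball, c, r', hr', ?_, ?_⟩, ?_⟩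
    · have : r' ≤ ε / 2 := min_le_left _ _
      linarith
    · intro b
      refine ⟨(Metric.closedBall_subset_closedBall ?_).trans (hrT b), iInter_subset _ b⟩
      cases b <;> simp [r']
    · exact mem_iInter.2 fun b => ⟨c b, Metric.mem_ball_self hr', hcy b⟩)
  let ι := {p : ℕ × Set Y // p.2 ∈ V p.1}
  have hdat : ∀ i : ι, ∃ c r, D i.1.1 i.1.2 c r := by
    rintro ⟨⟨n, A⟩, hA⟩
    obtain ⟨N, ⟨-, c, r, h1, h2, h3⟩, hAN⟩ := (hV n).2.2 A hA
    exact ⟨c, r, h1, h2, fun b => ⟨(h3 b).1, hAN.trans (h3 b).2⟩⟩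
  choose c r hr hrε hcr using hdat
  obtain ⟨E, hEo, hEc, hEl, hEV⟩ := precise_refinement_closure (fun i : ι => i.1.2)
    (fun i => (hV i.1.1).1 _ i.2) (eq_univ_of_forall fun y => by
      have : y ∈ ⋃₀ (⋃ n, V n) := hVc ▸ mem_univ y
      obtain ⟨A, hA, hy⟩ := this
      obtain ⟨n, hA⟩ := mem_iUnion.1 hA
      exact mem_iUnion.2 ⟨⟨(n, A), hA⟩, hy⟩)
  have hcl : ∀ b, closure (⋃ i, Metric.ball (c i b) (r i) ∩ f ⁻¹' E i) ⊆
      ⋃ i, Metric.closedBall (c i b) (r i) ∩ f ⁻¹' closure (E i) := by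
    intro b
    rw [LocallyFinite.closure_iUnion
      ((hEl.preimage_continuous hf).subset fun i => inter_subset_right)]
    refine iUnion_mono fun i => ?_
    refine closure_minimal ?_ (Metric.isClosed_closedBall.inter (isClosed_closure.preimage hf))
    exact inter_subset_inter Metric.ball_subset_closedBall (preimage_mono subset_closure)
  refine ⟨fun b => ⋃ i, Metric.ball (c i b) (r i) ∩ f ⁻¹' E i, ?_, ?_, ?_, ?_⟩
  · intro b
    refine ⟨isOpen_iUnion fun i => Metric.isOpen_ball.inter ((hEo i).preimage hf), fun y => ?_⟩
    obtain ⟨i, hi⟩ := mem_iUnion.1 (hEc.symm ▸ mem_univ y : y ∈ ⋃ i, E i)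
    obtain ⟨x, hx, rfl⟩ := (hcr i b).2 (hEV i (subset_closure hi))
    exact ⟨x, mem_iUnion.2 ⟨i, hx, hi⟩, rfl⟩
  · intro b x hx
    obtain ⟨i, hi, -⟩ := mem_iUnion.1 (hcl b hx)
    exact hSU _ ((hcr i b).1 hi)
  · rw [disjoint_left]
    intro x hx hx'
    obtain ⟨i, hi, -⟩ := mem_iUnion.1 (hcl _ hx)
    obtain ⟨j, hj, -⟩ := mem_iUnion.1 (hcl _ hx')
    exact disjoint_left.1 (hTd i.1.1 true j.1.1 false (Or.inr (by simp))) ((hcr i _).1 hi)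
      ((hcr j _).1 hj)
  · intro b y
    refine ⟨(fun i => Metric.closedBall (c i b) (r i)) '' {i | y ∈ closure (E i)},
      (hEl.closure.point_finite y).image _, ?_, ?_, ?_, ?_⟩
    · rintro _ ⟨i, -, rfl⟩
      exact Metric.isClosed_closedBall
    · rintro _ ⟨i, hi, rfl⟩ _ ⟨j, hj, rfl⟩ hij
      have hne : i.1.1 ≠ j.1.1 := by
        intro hn
        apply hij
        suffices i = j by rw [this]
        obtain ⟨⟨n, A⟩, hA⟩ := i
        obtain ⟨⟨m, B⟩, hB⟩ := j
        simp only at hn hA hB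
        subst hn
        have : A = B := by
          by_contra hAB
          exact disjoint_left.1 ((hV n).2.1 hA hB hAB) (hEV _ hi) (hEV _ hj)
        subst this
        rfl
      exact (hTd _ b _ b (Or.inl hne)).mono (hcr i b).1 (hcr j b).1
    · rintro _ ⟨i, hi, rfl⟩ x hx x' hx'
      have h1 := Metric.mem_closedBall.1 hx
      have h2 := Metric.mem_closedBall'.1 hx'
      have := dist_triangle x (c i b) x'
      have := hrε i
      linarith
    · rintro x ⟨hx, hxy⟩
      obtain ⟨i, hi, hi'⟩ := mem_iUnion.1 (hcl b hx)
      have : f x = y := hxy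
      exact ⟨_, ⟨i, this ▸ hi', rfl⟩, hi⟩

theorem totallyBounded_of_cover {X : Type*} [MetricSpace X] {K : Set X}
    (h : ∀ ε > 0, ∃ 𝓕 : Set (Set X), 𝓕.Finite ∧ (∀ F ∈ 𝓕, ∀ x ∈ F, ∀ x' ∈ F, dist x x' < ε) ∧
      K ⊆ ⋃₀ 𝓕) : TotallyBounded K := by
  classical
  rw [Metric.totallyBounded_iff]
  intro ε hε
  obtain ⟨𝓕, hfin, hd, hc⟩ := h ε hε
  rcases isEmpty_or_nonempty X with hE | ⟨⟨x₀⟩⟩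
  · exact ⟨∅, finite_empty, fun x => hE.elim x⟩
  refine ⟨(fun F : Set X => if hF : F.Nonempty then hF.some else x₀) '' 𝓕, hfin.image _, ?_⟩
  intro x hx
  obtain ⟨F, hF, hxF⟩ := hc hx
  have hne : F.Nonempty := ⟨x, hxF⟩
  refine mem_biUnion (mem_image_of_mem _ hF) ?_
  simp only [hne, dif_pos, Metric.mem_ball]
  exact hd F hF _ hxF _ hne.some_mem

theorem isComplete_closed_subset {X : Type*} [MetricSpace X] {s t : Set X} (hs : IsComplete s)
    (ht : IsClosed t) (hts : t ⊆ s) : IsComplete t := by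
  intro l hl hlt
  obtain ⟨x, -, hx⟩ := hs l hl (hlt.trans (principal_mono.2 hts))
  have := hl.1
  exact ⟨x, ht.mem_of_tendsto (f := id) hx (le_principal_iff.1 hlt), hx⟩

/-- A preconnected set covered by finitely many disjoint closed small sets is small. -/
theorem dist_le_of_preconnected {X : Type*} [MetricSpace X] {S : Set X} (hS : IsPreconnected S)
    {𝓕 : Set (Set X)} (hfin : 𝓕.Finite) (hcl : ∀ F ∈ 𝓕, IsClosed F) (hd : 𝓕.PairwiseDisjoint id)
    {ε : ℝ} (hε : ∀ F ∈ 𝓕, ∀ x ∈ F, ∀ x' ∈ F, dist x x' ≤ ε) (hc : S ⊆ ⋃₀ 𝓕)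
    {x x' : X} (hx : x ∈ S) (hx' : x' ∈ S) : dist x x' ≤ ε := by
  obtain ⟨F, hF, hxF⟩ := hc hx
  have hcl2 : IsClosed (⋃₀ (𝓕 \ {F})) := by
    rw [sUnion_eq_biUnion]
    exact (hfin.subset sdiff_subset).isClosed_biUnion (fun G hG => hcl G hG.1)
  have hcov : S ⊆ F ∪ ⋃₀ (𝓕 \ {F}) := by
    intro z hz
    obtain ⟨G, hG, hzG⟩ := hc hz
    by_cases h : G = F
    · exact Or.inl (h ▸ hzG)
    · exact Or.inr ⟨G, ⟨hG, h⟩, hzG⟩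
  have hdis : Disjoint F (⋃₀ (𝓕 \ {F})) := by
    rw [disjoint_sUnion_right]
    intro G hG
    exact hd hF hG.1 (fun h => hG.2 h.symm)
  rcases (isPreconnected_iff_subset_of_disjoint_closed.1 hS) F _ (hcl F hF) hcl2 hcov
    (by rw [hdis.inter_eq, inter_empty]) with h | h
  · exact hε F hF _ hxF _ (h hx')
  · exact absurd (h hx) (disjoint_left.1 hdis hxF)

theorem statement13 {X Y : Type*} [MetricSpace X]
    [TopologicalSpace Y] [T2Space Y] [ParacompactSpace Y] (hY : IsCSpace Y)
    (f : X → Y) (hf : Continuous f) (hopen : IsOpenMap f) (hsurj : Function.Surjective f)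
    (hdense : ∀ y : Y, ∀ x ∈ f ⁻¹' {y}, AccPt x (𝓟 (f ⁻¹' {y})))
    (hcompl : ∀ y : Y, IsComplete (f ⁻¹' {y}))
    (U : Set X) (hU : IsOpen U) (hUsec : f '' U = Set.univ) :
    ∃ (H : Set X) (ℓ : ↥H → Y × (ℕ → Bool)),
      IsClosed H ∧ H ⊆ U ∧ f '' H = Set.univ ∧
      Continuous ℓ ∧ Function.Surjective ℓ ∧
      (∀ p : Y × (ℕ → Bool), IsCompact (ℓ ⁻¹' {p}) ∧ CovDimZero ↥(ℓ ⁻¹' {p})) ∧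
      (∀ x : ↥H, (ℓ x).1 = f ↑x) ∧
      (∀ y : Y, IsCompact {x ∈ H | f x = y} ∧ CovDimZero ↥{x ∈ H | f x = y}) := by
  have hU0 : OSec f U := ⟨hU, fun y => by
    have : y ∈ f '' U := hUsec ▸ mem_univ y
    exact this⟩
  have hstep := fun (n : ℕ) (R : {U : Set X // OSec f U}) =>
    exists_step hY hf hopen hdense R.2 (ε := 1 / ((n : ℝ) + 1)) Nat.one_div_pos_of_nat
  choose V hVsec hVcl hVd hVF using hstep
  choose 𝓕 h𝓕fin h𝓕cl h𝓕d h𝓕ε h𝓕c using hVF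
  let u : (ℕ → Bool) → ℕ → {U : Set X // OSec f U} := fun σ n =>
    Nat.rec ⟨U, hU0⟩ (fun n R => ⟨V n R (σ n), hVsec n R (σ n)⟩) n
  have hus : ∀ σ n, (u σ (n + 1)).1 = V n (u σ n) (σ n) := fun σ n => rfl
  have hcls : ∀ σ n, closure (u σ (n + 1)).1 ⊆ (u σ n).1 := fun σ n => hVcl n (u σ n) (σ n)
  have hanti : ∀ σ, Antitone fun n => (u σ n).1 := fun σ =>
    antitone_nat_of_succ_le fun n => subset_closure.trans (hcls σ n)
  have hantic : ∀ σ m n, m ≤ n → closure (u σ n).1 ⊆ closure (u σ m).1 := fun σ m n h =>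
    closure_mono (hanti σ h)
  have hpre : ∀ σ τ n, (∀ k < n, σ k = τ k) → u σ n = u τ n := by
    intro σ τ n h
    induction n with
    | zero => rfl
    | succ n ih =>
      have h1 := ih fun k hk => h k (by omega)
      apply Subtype.ext
      rw [hus, hus, h1, h n (by omega)]
  have huniq : ∀ x σ τ n, x ∈ closure (u σ n).1 → x ∈ closure (u τ n).1 → ∀ k < n, σ k = τ k := by
    intro x σ τ n
    induction n with
    | zero => intro _ _ k hk; omega
    | succ n ih =>
      intro h1 h2
      have h3 := ih (hantic σ n (n + 1) (by omega) h1) (hantic τ n (n + 1) (by omega) h2)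
      intro k hk
      rcases Nat.lt_succ_iff_lt_or_eq.1 hk with hk | rfl
      · exact h3 k hk
      · have h4 := hpre σ τ k h3
        rw [hus] at h1 h2
        rw [← h4] at h2
        cases hσ : σ k <;> cases hτ : τ k <;> rw [hσ] at h1 <;> rw [hτ] at h2
        · exact absurd h1 (by first | exact disjoint_left.1 (hVd k (u σ k)) h2 | exact disjoint_right.1 (hVd k (u σ k)) h2)
        · exact absurd h2 (by first | exact disjoint_left.1 (hVd k (u σ k)) h1 | exact disjoint_right.1 (hVd k (u σ k)) h1)
  have hfinr : ∀ n, (range fun σ => u σ n).Finite := by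
    intro n
    induction n with
    | zero => exact (finite_singleton _).subset (by rintro _ ⟨σ, rfl⟩; exact mem_singleton _)
    | succ n ih =>
      refine ((ih.prod (finite_univ (α := Bool))).image
        (fun p => (⟨V n p.1 p.2, hVsec n p.1 p.2⟩ : {U : Set X // OSec f U}))).subset ?_
      rintro _ ⟨σ, rfl⟩
      exact ⟨(u σ n, σ n), ⟨⟨σ, rfl⟩, mem_univ _⟩, rfl⟩
  let H : Set X := ⋂ n, ⋃ σ, closure (u σ n).1
  have hHcl : IsClosed H := by
    refine isClosed_iInter fun n => ?_
    have : (⋃ σ, closure (u σ n).1) = ⋃ R ∈ range (fun σ => u σ n), closure R.1 := by simp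
    rw [this]
    exact (hfinr n).isClosed_biUnion fun R _ => isClosed_closure
  have hHτ : ∀ (x : H) n, ∃ σ, x.1 ∈ closure (u σ n).1 := fun x n =>
    mem_iUnion.1 (mem_iInter.1 x.2 n)
  choose τ hτ using hHτ
  let br : H → ℕ → Bool := fun x k => τ x (k + 1) k
  have hbr : ∀ x n, x.1 ∈ closure (u (br x) n).1 := by
    intro x n
    have : u (br x) n = u (τ x n) n := hpre _ _ _ fun k hk =>
      huniq x.1 _ _ (k + 1) (hτ x (k + 1)) (hantic _ _ _ hk (hτ x n)) k (by omega)
    rw [this]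
    exact hτ x n
  have hbro : ∀ x n, x.1 ∈ (u (br x) n).1 := fun x n => hcls _ _ (hbr x (n + 1))
  have hbrcont : Continuous br := by
    refine continuous_pi fun k => ?_
    have : ∀ b, (fun x => br x k) ⁻¹' {b} =
        Subtype.val ⁻¹' (⋃ σ ∈ {σ : ℕ → Bool | σ k = b}, (u σ (k + 1)).1) := by
      intro b
      ext x
      simp only [mem_preimage, mem_singleton_iff, mem_iUnion, mem_ofPred_eq, exists_prop]
      constructor
      · intro h
        exact ⟨br x, h, hbro x (k + 1)⟩
      · rintro ⟨σ, rfl, hσ⟩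
        exact huniq x.1 _ _ (k + 1) (hbr x (k + 1)) (subset_closure hσ) k (by omega)
    refine continuous_discrete_rng.2 fun b => ?_
    rw [this b]
    exact (isOpen_biUnion fun σ _ => (u σ (k + 1)).2.1).preimage continuous_subtype_val
  have hHU : H ⊆ U := fun x hx => hbro ⟨x, hx⟩ 0
  -- every branch is hit over every point
  have hhit : ∀ y σ, ∃ x : H, f x = y ∧ br x = σ := by
    intro y σ
    choose a ha hay using fun n => (u σ n).2.2 y
    have htb : TotallyBounded (range a) := by
      refine totallyBounded_of_cover fun ε hε => ?_
      obtain ⟨n, hn⟩ := exists_nat_one_div_lt hε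
      refine ⟨𝓕 n (u σ n) (σ n) y ∪ (fun m => {a m}) '' Iic n,
        (h𝓕fin _ _ _ _).union ((finite_Iic n).image _), ?_, ?_⟩
      · rintro F (hF | ⟨m, -, rfl⟩) x hx x' hx'
        · exact (h𝓕ε _ _ _ _ F hF x hx x' hx').trans_lt hn
        · rw [mem_singleton_iff.1 hx, mem_singleton_iff.1 hx', dist_self]
          exact hε
      · rintro _ ⟨m, rfl⟩
        rcases le_or_gt m n with h | h
        · exact ⟨{a m}, Or.inr ⟨m, h, rfl⟩, rfl⟩
        · have h1 : a m ∈ (u σ (n + 1)).1 := hanti σ h (ha m)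
          obtain ⟨F, hF, hx⟩ := h𝓕c n (u σ n) (σ n) y ⟨subset_closure h1, hay m⟩
          exact ⟨F, Or.inl hF, hx⟩
    have hfc : IsClosed (f ⁻¹' {y}) := isClosed_singleton.preimage hf
    have hsub : closure (range a) ⊆ f ⁻¹' {y} :=
      closure_minimal (by rintro _ ⟨m, rfl⟩; exact hay m) hfc
    have hcomp : IsCompact (closure (range a)) := isCompact_iff_totallyBounded_isComplete.2
      ⟨htb.closure, isComplete_closed_subset (hcompl y) isClosed_closure hsub⟩
    obtain ⟨x, hx, φ, hφ, hlim⟩ := hcomp.tendsto_subseq (fun n => subset_closure (mem_range_self n))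
    have hxu : ∀ n, x ∈ closure (u σ n).1 := by
      intro n
      refine mem_closure_of_tendsto hlim ?_
      filter_upwards [eventually_ge_atTop n] with m hm
      exact hanti σ (hm.trans (hφ.id_le m)) (ha (φ m))
    refine ⟨⟨x, mem_iInter.2 fun n => mem_iUnion.2 ⟨σ, hxu n⟩⟩, hsub hx, ?_⟩
    funext k
    exact huniq x _ _ (k + 1) (hbr _ (k + 1)) (hxu (k + 1)) k (by omega)
  -- compactness of fibers
  have hKc : ∀ y, IsCompact {x ∈ H | f x = y} := by
    intro y
    have hKcl : IsClosed {x ∈ H | f x = y} := hHcl.inter (isClosed_singleton.preimage hf)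
    refine isCompact_iff_totallyBounded_isComplete.2
      ⟨?_, isComplete_closed_subset (hcompl y) hKcl fun x hx => hx.2⟩
    refine totallyBounded_of_cover fun ε hε => ?_
    obtain ⟨n, hn⟩ := exists_nat_one_div_lt hε
    refine ⟨⋃ p ∈ (range fun σ => u σ n) ×ˢ (univ : Set Bool), 𝓕 n p.1 p.2 y,
      ((hfinr n).prod finite_univ).biUnion fun p _ => h𝓕fin _ _ _ _, ?_, ?_⟩
    · intro F hF x hx x' hx'
      simp only [mem_iUnion] at hF
      obtain ⟨p, -, hF⟩ := hF
      exact (h𝓕ε _ _ _ _ F hF x hx x' hx').trans_lt hn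
    · rintro x ⟨hxH, hxy⟩
      have h1 := hbr ⟨x, hxH⟩ (n + 1)
      rw [hus] at h1
      obtain ⟨F, hF, hx⟩ := h𝓕c n _ _ y ⟨h1, hxy⟩
      exact ⟨F, mem_biUnion (x := (u (br ⟨x, hxH⟩) n, br ⟨x, hxH⟩ n))
        ⟨⟨_, rfl⟩, mem_univ _⟩ hF, hx⟩
  -- total disconnectedness
  have hKt : ∀ (y : Y) (S : Set H), (∀ x ∈ S, f x.1 = y) → IsPreconnected S → S.Subsingleton := by
    intro y S hSy hS x hx x' hx'
    have hconst : ∀ z ∈ S, br z = br x := by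
      intro z hz
      exact (hS.image br hbrcont.continuousOn).subsingleton ⟨z, hz, rfl⟩ ⟨x, hx, rfl⟩
    have hS' : IsPreconnected (Subtype.val '' S) := hS.image _ continuous_subtype_val.continuousOn
    apply Subtype.ext
    refine eq_of_forall_dist_le fun ε hε => ?_
    obtain ⟨n, hn⟩ := exists_nat_one_div_lt hε
    refine le_trans ?_ hn.le
    refine dist_le_of_preconnected hS' (h𝓕fin n (u (br x) n) (br x n) y) (h𝓕cl _ _ _ _)
      (h𝓕d _ _ _ _) (h𝓕ε _ _ _ _) ?_ ⟨x, hx, rfl⟩ ⟨x', hx', rfl⟩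
    rintro _ ⟨z, hz, rfl⟩
    refine h𝓕c _ _ _ _ ⟨?_, hSy z hz⟩
    have := hbr z (n + 1)
    rwa [hconst z hz] at this
  have hℓc : Continuous fun x : H => (f x.1, br x) :=
    (hf.comp continuous_subtype_val).prodMk hbrcont
  refine ⟨H, fun x => (f x, br x), hHcl, hHU, ?_, hℓc, ?_, ?_, fun x => rfl, ?_⟩
  · refine eq_univ_of_forall fun y => ?_
    obtain ⟨x, hx, -⟩ := hhit y (fun _ => true)
    exact ⟨x, x.2, hx⟩
  · rintro ⟨y, σ⟩
    obtain ⟨x, hx, hx'⟩ := hhit y σ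
    exact ⟨x, Prod.ext hx hx'⟩
  · rintro ⟨y, σ⟩
    have hcK : IsCompact (Subtype.val ⁻¹' {x ∈ H | f x = y} : Set H) := by
      rw [Subtype.isCompact_iff, Subtype.image_preimage_coe, inter_eq_right.2 (fun x hx => hx.1)]
      exact hKc y
    have hc : IsCompact ((fun x : H => (f x.1, br x)) ⁻¹' {(y, σ)}) :=
      hcK.of_isClosed_subset (isClosed_singleton.preimage hℓc)
        (fun x hx => ⟨x.2, congrArg Prod.fst hx⟩)
    refine ⟨hc, ?_⟩
    have := isCompact_iff_compactSpace.1 hc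
    have : TotallyDisconnectedSpace ↥((fun x : H => (f x.1, br x)) ⁻¹' {(y, σ)}) := by
      rw [totallyDisconnectedSpace_subtype_iff]
      intro S hS hSc
      exact hKt y S (fun x hx => congrArg Prod.fst (hS hx)) hSc
    exact covDimZero_of_profinite
  · intro y
    refine ⟨hKc y, ?_⟩
    have := isCompact_iff_compactSpace.1 (hKc y)
    have : TotallyDisconnectedSpace ↥{x ∈ H | f x = y} := by
      refine ⟨fun S _ hSc => ?_⟩
      let j : ↥{x ∈ H | f x = y} → H := fun x => ⟨x.1, x.2.1⟩
      have hj : Continuous j := continuous_subtype_val.subtype_mk _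
      have h1 := hKt y (j '' S) (by rintro _ ⟨x, -, rfl⟩; exact x.2.2)
        (hSc.image _ hj.continuousOn)
      intro x hx x' hx'
      have := h1 ⟨x, hx, rfl⟩ ⟨x', hx', rfl⟩
      exact Subtype.ext (congrArg (fun z : H => z.1) this)
    exact covDimZero_of_profinite
end

section
/- Let (X,d) be a metric space, Y a paracompact Hausdorff C-space, and f : X → Y an open continuous surjection such that each fiber f⁻¹(y) is dense in itself (has no isolated points) and d-complete. Let 𝒻(f) = {H : H is a nonempty closed subset of X with f(H) = Y}, considered as a subspace of the hyperspace of nonempty closed subsets of X with the Vietoris topology. Then the set 𝓛(f) = {H ∈ 𝒻(f) : f↾H is a compact light map} is dense in 𝒻(f) with respect to the Vietoris topology. -/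
open Set Topology Filter

/-- The hyperspace `𝒻(X)` of nonempty closed subsets of `X`. -/
structure Hyper (X : Type*) [TopologicalSpace X] where
  carrier : Set X
  isClosed' : IsClosed carrier
  nonempty' : carrier.Nonempty

/-- The Vietoris topology on `𝒻(X)`, generated by the sets
`⟨𝒱⟩ = {S : S ⊆ ⋃𝒱 and S ∩ V ≠ ∅ for all V ∈ 𝒱}` for finite families `𝒱` of open sets. -/
instance Hyper.instTopologicalSpace (X : Type*) [TopologicalSpace X] :
    TopologicalSpace (Hyper X) :=
  TopologicalSpace.generateFrom
    {T : Set (Hyper X) | ∃ 𝒱 : Finset (Set X), (∀ V ∈ 𝒱, IsOpen V) ∧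
      T = {S : Hyper X | S.carrier ⊆ ⋃₀ (𝒱 : Set (Set X)) ∧
        ∀ V ∈ 𝒱, (S.carrier ∩ V).Nonempty}}

open Metric

def FinPart {X : Type*} [MetricSpace X] (ε : ℝ) (S : Set X) : Prop :=
  ∃ P : Set (Set X), P.Finite ∧ (∀ A ∈ P, IsClosed A ∧ ∀ x ∈ A, ∀ y ∈ A, dist x y ≤ ε) ∧
    P.Pairwise Disjoint ∧ ⋃₀ P = S

theorem FinPart.mono {X : Type*} [MetricSpace X] {ε : ℝ} {S S' : Set X} (h : FinPart ε S)
    (hc : IsClosed S') (hs : S' ⊆ S) : FinPart ε S' := by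
  obtain ⟨P, hf, hA, hd, rfl⟩ := h
  refine ⟨(fun A => A ∩ S') '' P, hf.image _, ?_, ?_, ?_⟩
  · rintro _ ⟨A, hAP, rfl⟩
    exact ⟨(hA A hAP).1.inter hc, fun x hx y hy => (hA A hAP).2 x hx.1 y hy.1⟩
  · rintro _ ⟨A, hAP, rfl⟩ _ ⟨B, hBP, rfl⟩ hne
    have : A ≠ B := by rintro rfl; exact hne rfl
    exact (hd hAP hBP this).mono inter_subset_left inter_subset_left
  · ext x
    simp only [sUnion_image, mem_iUnion, mem_inter_iff, exists_prop]
    constructor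
    · rintro ⟨A, _, _, h⟩; exact h
    · intro h
      obtain ⟨A, hAP, hx⟩ := hs h
      exact ⟨A, hAP, hx, h⟩

theorem FinPart.insert_point {X : Type*} [MetricSpace X] {ε : ℝ} (hε : 0 ≤ ε) {S : Set X}
    (h : FinPart ε S) (p : X) : FinPart ε (insert p S) := by
  by_cases hp : p ∈ S
  · rwa [insert_eq_of_mem hp]
  obtain ⟨P, hf, hA, hd, rfl⟩ := h
  refine ⟨insert {p} P, hf.insert _, ?_, ?_, ?_⟩
  · rintro A (rfl | hAP)
    · refine ⟨isClosed_singleton, ?_⟩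
      rintro x rfl y rfl
      simpa using hε
    · exact hA A hAP
  · refine hd.insert_of_symm ?_
    intro B hB _
    rw [disjoint_singleton_left]
    exact fun h => hp ⟨B, hB, h⟩
  · rw [sUnion_insert]; rfl

theorem FinPart.union {X : Type*} [MetricSpace X] {ε : ℝ} (hε : 0 ≤ ε) {S : Set X}
    (h : FinPart ε S) {F : Set X} (hF : F.Finite) : FinPart ε (F ∪ S) := by
  induction F, hF using Set.Finite.induction_on with
  | empty => simpa using h
  | insert _ _ ih => rw [insert_union]; exact ih.insert_point hε _

theorem covDimZero_of_finPart {X : Type*} [MetricSpace X] {K : Set X} (hK : IsCompact K)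
    (h : ∀ ε > 0, FinPart ε K) : CovDimZero K := by
  classical
  intro 𝒰 hU hcov
  have : CompactSpace K := isCompact_iff_compactSpace.1 hK
  obtain ⟨δ, hδ, hL⟩ := lebesgue_number_lemma_of_metric_sUnion (s := (univ : Set K))
    (c := (𝒰 : Set (Set K))) isCompact_univ (fun t ht => hU t ht) hcov.ge
  obtain ⟨P, hf, hA, hd, hPK⟩ := h (δ / 2) (by positivity)
  have hQ : ((fun A : Set X => ((↑) ⁻¹' A : Set K)) '' P).Finite := hf.image _
  refine ⟨hQ.toFinset.filter (fun A => A.Nonempty), ?_, ?_, ?_, ?_⟩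
  · intro V hV
    simp only [Finset.mem_filter, Set.Finite.mem_toFinset] at hV
    obtain ⟨⟨A, hAP, rfl⟩, -⟩ := hV
    have : ((↑) ⁻¹' A : Set K) = (⋃ B ∈ P \ {A}, ((↑) ⁻¹' B : Set K))ᶜ := by
      ext x
      simp only [mem_preimage, mem_compl_iff, mem_iUnion, not_exists]
      constructor
      · intro hx B hB hxB
        exact (disjoint_left.1 (hd hAP hB.1 (fun h => hB.2 h.symm))) hx hxB
      · intro hx
        obtain ⟨B, hB, hxB⟩ := hPK.ge x.2
        by_cases hBA : B = A
        · rwa [hBA] at hxB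
        · exact absurd hxB (hx B ⟨hB, hBA⟩)
    change IsOpen ((↑) ⁻¹' A : Set K)
    rw [this, isOpen_compl_iff]
    exact (hf.subset sdiff_subset).isClosed_biUnion
      (fun B hB => (hA B hB.1).1.preimage continuous_subtype_val)
  · intro V hV V' hV' hne
    simp only [Finset.mem_filter, Set.Finite.mem_toFinset, mem_ofPred_eq] at hV hV'
    obtain ⟨⟨A, hAP, rfl⟩, -⟩ := hV
    obtain ⟨⟨B, hBP, rfl⟩, -⟩ := hV'
    have : A ≠ B := by rintro rfl; exact hne rfl
    exact (hd hAP hBP this).preimage _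
  · intro V hV
    simp only [Finset.mem_filter, Set.Finite.mem_toFinset] at hV
    obtain ⟨⟨A, hAP, rfl⟩, x, hx⟩ := hV
    obtain ⟨t, ht, hb⟩ := hL x (mem_univ _)
    refine ⟨t, ht, fun y hy => hb ?_⟩
    have := (hA A hAP).2 y hy x hx
    rw [mem_ball, Subtype.dist_eq]
    linarith
  · refine eq_univ_of_forall fun x => ?_
    obtain ⟨A, hAP, hx⟩ := hPK.ge x.2
    refine ⟨(Subtype.val ⁻¹' A : Set K), ?_, hx⟩
    simp only [Finset.coe_filter, Set.Finite.mem_toFinset, mem_ofPred_eq]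
    exact ⟨⟨A, hAP, rfl⟩, x, hx⟩

theorem ultra_lim {X : Type*} [MetricSpace X] {Z : Set X} (hZ : IsComplete Z)
    (S : ℕ → Set X) (hS : ∀ n, IsClosed (S n)) (hSZ : ∀ n, S n ⊆ Z)
    (hP : ∀ ε > 0, ∃ n, FinPart ε (S n)) (F : Ultrafilter X) (hF : ∀ n, S n ∈ F) :
    ∃ x ∈ ⋂ n, S n, (F : Filter X) ≤ 𝓝 x := by
  have hC : Cauchy (F : Filter X) := by
    rw [Metric.cauchy_iff]
    refine ⟨F.neBot, fun ε hε => ?_⟩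
    obtain ⟨n, P, hf, hA, hd, hPS⟩ := hP (ε / 2) (by positivity)
    have h1 := hF n
    rw [← hPS, Ultrafilter.finite_sUnion_mem_iff hf] at h1
    obtain ⟨A, hAP, hAF⟩ := h1
    refine ⟨A, hAF, fun x hx y hy => ?_⟩
    have := (hA A hAP).2 x hx y hy
    linarith
  obtain ⟨x, -, hx⟩ := hZ F hC (le_principal_iff.2 (mem_of_superset (hF 0) (hSZ 0)))
  refine ⟨x, mem_iInter.2 fun n => ?_, hx⟩
  exact (hS n).mem_of_tendsto (f := id) hx (hF n)

/-- Families of pairs (closed subset of the base, open subset of the total space over it). -/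
def GoodFam {X Y : Type*} [MetricSpace X] [TopologicalSpace Y] (f : X → Y)
    (𝒢 : Set (Set Y × Set X)) : Prop :=
  (∀ p ∈ 𝒢, IsClosed p.1 ∧ IsOpen p.2 ∧ p.1 ⊆ f '' p.2) ∧
    ∀ y, ∃ N ∈ 𝓝 y, {p ∈ 𝒢 | (p.1 ∩ N).Nonempty}.Finite

def stepFam {X Y : Type*} [MetricSpace X] [TopologicalSpace Y]
    (𝒢 : Set (Set Y × Set X)) (w : Y → Set Y) (c : Y → X) (r : Y → ℝ) :
    Set (Set Y × Set X) :=
  𝒢 ∪ {q | ∃ p ∈ 𝒢, ∃ z, q = (p.1 ∩ closure (w z), p.2 \ closedBall (c z) (r z))} ∪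
    {q | ∃ z, q = (closure (w z), ball (c z) (r z / 2))}

theorem step_point {X Y : Type*} [MetricSpace X] [TopologicalSpace Y] {f : X → Y}
    (hopen : IsOpenMap f)
    (hdense : ∀ y : Y, ∀ x ∈ f ⁻¹' {y}, AccPt x (𝓟 (f ⁻¹' {y})))
    {U : Set X} (hU : IsOpen U) (hUY : f '' U = univ) {ε : ℝ} (hε : 0 < ε)
    {𝒢 : Set (Set Y × Set X)} (h𝒢 : GoodFam f 𝒢) (z : Y) :
    ∃ (x : X) (r : ℝ) (W : Set Y), 0 < r ∧ r ≤ ε ∧ closedBall x r ⊆ U ∧ IsOpen W ∧ z ∈ W ∧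
      W ⊆ f '' ball x (r / 2) ∧
      ∀ p ∈ 𝒢, (p.1 ∩ W).Nonempty → W ⊆ f '' (p.2 \ closedBall x r) := by
  classical
  obtain ⟨N, hN, hfin⟩ := h𝒢.2 z
  have hex : ∀ p : Set Y × Set X, ∃ e : X, p ∈ 𝒢 → z ∈ p.1 → e ∈ p.2 ∧ f e = z := by
    intro p
    by_cases h : p ∈ 𝒢 ∧ z ∈ p.1
    · obtain ⟨e, he, hz⟩ := (h𝒢.1 p h.1).2.2 h.2
      exact ⟨e, fun _ _ => ⟨he, hz⟩⟩
    · obtain ⟨e, -⟩ := hUY.ge (mem_univ z)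
      exact ⟨e, fun h1 h2 => absurd ⟨h1, h2⟩ h⟩
  choose e he using hex
  set E := e '' {p ∈ 𝒢 | (p.1 ∩ N).Nonempty} with hE
  have hEfin : E.Finite := hfin.image e
  obtain ⟨x0, hx0U, hx0⟩ := hUY.ge (mem_univ z)
  obtain ⟨x, ⟨⟨hxU, hxE⟩, hxz⟩, hxne⟩ := accPt_iff_nhds.1 (hdense z x0 hx0) (U ∩ (E \ {x0})ᶜ)
    ((hU.inter (hEfin.subset sdiff_subset).isClosed.isOpen_compl).mem_nhds ⟨hx0U, by simp⟩)
  have hxE' : x ∉ E := fun h => hxE ⟨h, hxne⟩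
  have hnh : U ∩ Eᶜ ∈ 𝓝 x := (hU.inter hEfin.isClosed.isOpen_compl).mem_nhds ⟨hxU, hxE'⟩
  obtain ⟨r0, hr0, hr0U⟩ := Metric.nhds_basis_closedBall.mem_iff.1 hnh
  set r := min r0 ε with hr
  have hrpos : 0 < r := lt_min hr0 hε
  have hrU : closedBall x r ⊆ U ∩ Eᶜ := (closedBall_subset_closedBall (min_le_left _ _)).trans hr0U
  refine ⟨x, r, interior N ∩ f '' ball x (r / 2) ∩ ⋂ p ∈ {p ∈ 𝒢 | (p.1 ∩ N).Nonempty},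
    (if z ∈ p.1 then f '' (p.2 \ closedBall x r) else p.1ᶜ), hrpos, min_le_right _ _,
    hrU.trans inter_subset_left, ?_, ?_, ?_, ?_⟩
  · refine (isOpen_interior.inter (hopen _ isOpen_ball)).inter (hfin.isOpen_biInter ?_)
    intro p hp
    split_ifs
    · exact hopen _ ((h𝒢.1 p hp.1).2.1.sdiff isClosed_closedBall)
    · exact (h𝒢.1 p hp.1).1.isOpen_compl
  · refine ⟨⟨mem_interior_iff_mem_nhds.2 hN, x, mem_ball_self (by positivity), hxz⟩, ?_⟩
    refine mem_iInter₂.2 fun p hp => ?_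
    split_ifs with h
    · refine ⟨e p, ⟨(he p hp.1 h).1, fun hb => ?_⟩, (he p hp.1 h).2⟩
      exact (hrU hb).2 ⟨p, hp, rfl⟩
    · exact h
  · exact fun y hy => hy.1.2
  · rintro p hp ⟨y, hyp, hyW⟩ y' hy'
    have hp' : p ∈ {p ∈ 𝒢 | (p.1 ∩ N).Nonempty} :=
      ⟨hp, y, hyp, interior_subset hyW.1.1⟩
    have h1 := mem_iInter₂.1 hyW.2 p hp'
    have h2 := mem_iInter₂.1 hy'.2 p hp'
    split_ifs at h1 h2 with h
    · exact h2
    · exact absurd hyp h1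

structure Stage {X Y : Type*} [MetricSpace X] [TopologicalSpace Y] (U : Set X)
    (ε : ℝ) (w : Y → Set Y) (c : Y → X) (r : Y → ℝ) : Prop where
  isOpen : ∀ z, IsOpen (w z)
  cover : ⋃ z, w z = univ
  pos : ∀ z, 0 < r z
  le : ∀ z, r z ≤ ε
  sub : ∀ z, closedBall (c z) (r z) ⊆ U

theorem step_stage {X Y : Type*} [MetricSpace X] [TopologicalSpace Y] [T2Space Y]
    [ParacompactSpace Y] {f : X → Y} (hopen : IsOpenMap f)
    (hdense : ∀ y : Y, ∀ x ∈ f ⁻¹' {y}, AccPt x (𝓟 (f ⁻¹' {y})))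
    {U : Set X} (hU : IsOpen U) (hUY : f '' U = univ) {ε : ℝ} (hε : 0 < ε)
    {𝒢 : Set (Set Y × Set X)} (h𝒢 : GoodFam f 𝒢) :
    ∃ (w : Y → Set Y) (c : Y → X) (r : Y → ℝ), Stage U ε w c r ∧ GoodFam f (stepFam 𝒢 w c r) := by
  choose c r W hr hrε hcU hWo hzW hWb hWp using step_point hopen hdense hU hUY hε h𝒢
  have h1 : ∀ z, ∃ t, IsOpen t ∧ z ∈ t ∧ closure t ⊆ W z := by
    intro z
    obtain ⟨t, ht, htc, htW⟩ := exists_mem_nhds_isClosed_subset ((hWo z).mem_nhds (hzW z))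
    exact ⟨interior t, isOpen_interior, mem_interior_iff_mem_nhds.2 ht,
      (closure_minimal interior_subset htc).trans htW⟩
  choose t hto hzt htW using h1
  obtain ⟨w, hwo, hwc, hwlf, hwt⟩ := precise_refinement t hto
    (eq_univ_of_forall fun z => mem_iUnion.2 ⟨z, hzt z⟩)
  have hwW : ∀ z, closure (w z) ⊆ W z := fun z => (closure_mono (hwt z)).trans (htW z)
  refine ⟨w, c, r, ⟨hwo, hwc, hr, hrε, hcU⟩, ?_, ?_⟩
  · rintro q ((hq | ⟨p, hp, z, rfl⟩) | ⟨z, rfl⟩)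
    · exact h𝒢.1 q hq
    · refine ⟨(h𝒢.1 p hp).1.inter isClosed_closure,
        (h𝒢.1 p hp).2.1.sdiff isClosed_closedBall, ?_⟩
      rintro y ⟨hy1, hy2⟩
      exact hWp z p hp ⟨y, hy1, hwW z hy2⟩ (hwW z hy2)
    · exact ⟨isClosed_closure, isOpen_ball, (hwW z).trans (hWb z)⟩
  · intro y
    obtain ⟨N, hN, hfin⟩ := h𝒢.2 y
    obtain ⟨M, hM, hMfin⟩ := hwlf.closure y
    refine ⟨N ∩ M, inter_mem hN hM, ?_⟩
    refine ((hfin.union ((hfin.prod hMfin).image (fun q : (Set Y × Set X) × Y =>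
      (q.1.1 ∩ closure (w q.2), q.1.2 \ closedBall (c q.2) (r q.2))))).union
      (hMfin.image fun z => (closure (w z), ball (c z) (r z / 2)))).subset ?_
    rintro q ⟨(hq | ⟨p, hp, z, rfl⟩) | ⟨z, rfl⟩, a, ha, haN, haM⟩
    · exact Or.inl (Or.inl ⟨hq, a, ha, haN⟩)
    · exact Or.inl (Or.inr ⟨(p, z), ⟨⟨hp, a, ha.1, haN⟩, ⟨a, ha.2, haM⟩⟩, rfl⟩)
    · exact Or.inr ⟨z, ⟨a, ha, haM⟩, rfl⟩

theorem exists_stages {X Y : Type*} [MetricSpace X] [TopologicalSpace Y] [T2Space Y]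
    [ParacompactSpace Y] {f : X → Y} (hopen : IsOpenMap f)
    (hdense : ∀ y : Y, ∀ x ∈ f ⁻¹' {y}, AccPt x (𝓟 (f ⁻¹' {y})))
    {U : Set X} (hU : IsOpen U) (hUY : f '' U = univ) {ε : ℝ} (hε : 0 < ε) :
    ∃ (𝒢 : ℕ → Set (Set Y × Set X)) (w : ℕ → Y → Set Y) (c : ℕ → Y → X) (r : ℕ → Y → ℝ),
      (∀ n, GoodFam f (𝒢 n)) ∧ (∀ n, Stage U ε (w n) (c n) (r n)) ∧
      ∀ n, 𝒢 (n + 1) = stepFam (𝒢 n) (w n) (c n) (r n) := by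
  choose w c r hS hG using fun 𝒢 : {𝒢 : Set (Set Y × Set X) // GoodFam f 𝒢} =>
    step_stage hopen hdense hU hUY hε 𝒢.2
  have h0 : GoodFam f (∅ : Set (Set Y × Set X)) :=
    ⟨fun p hp => absurd hp (notMem_empty p), fun y => ⟨univ, univ_mem, by simp⟩⟩
  let 𝒢 : ℕ → {𝒢 : Set (Set Y × Set X) // GoodFam f 𝒢} := fun n =>
    Nat.rec ⟨∅, h0⟩ (fun _ G => ⟨stepFam G.1 (w G) (c G) (r G), hG G⟩) n
  exact ⟨fun n => (𝒢 n).1, fun n => w (𝒢 n), fun n => c (𝒢 n), fun n => r (𝒢 n),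
    fun n => (𝒢 n).2, fun n => hS _, fun n => rfl⟩

theorem shrink_open {X Y : Type*} [MetricSpace X] [TopologicalSpace Y] [T2Space Y]
    [ParacompactSpace Y] (hY : IsCSpace Y) {f : X → Y} (hf : Continuous f) (hopen : IsOpenMap f)
    (hdense : ∀ y : Y, ∀ x ∈ f ⁻¹' {y}, AccPt x (𝓟 (f ⁻¹' {y})))
    {U : Set X} (hU : IsOpen U) (hUY : f '' U = univ) {ε : ℝ} (hε : 0 < ε) :
    ∃ U' : Set X, IsOpen U' ∧ f '' U' = univ ∧ closure U' ⊆ U ∧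
      ∀ y, FinPart ε (closure U' ∩ f ⁻¹' {y}) := by
  obtain ⟨𝒢, w, c, r, h𝒢, hS, hstep⟩ := exists_stages hopen hdense hU hUY hε
  obtain ⟨𝒱, h𝒱, h𝒱c⟩ := hY (fun n => range (w n)) (fun n => ⟨by
    rintro _ ⟨z, rfl⟩; exact (hS n).isOpen z, by rw [sUnion_range]; exact (hS n).cover⟩)
  let ι := {p : ℕ × Set Y // p.2 ∈ 𝒱 p.1}
  have hz : ∀ i : ι, ∃ z, i.1.2 ⊆ w i.1.1 z := by
    intro i
    obtain ⟨_, ⟨z, rfl⟩, h⟩ := (h𝒱 i.1.1).2.2 i.1.2 i.2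
    exact ⟨z, h⟩
  choose z hz using hz
  have hdisj : ∀ i j : ι, i.1.1 = j.1.1 → (i.1.2 ∩ j.1.2).Nonempty → i = j := by
    rintro ⟨⟨n, A⟩, hA⟩ ⟨⟨m, B⟩, hB⟩ h hne
    obtain rfl : n = m := h
    by_contra hAB
    have : A ≠ B := by rintro rfl; exact hAB rfl
    exact not_disjoint_iff_nonempty_inter.2 hne ((h𝒱 n).2.1 hA hB this)
  obtain ⟨t, hto, htc, htlf, htV⟩ := precise_refinement (fun i : ι => i.1.2)
    (fun i => (h𝒱 i.1.1).1 _ i.2) (by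
      refine eq_univ_of_forall fun y => ?_
      obtain ⟨V, hV, hy⟩ := h𝒱c.ge (mem_univ y)
      obtain ⟨n, hn⟩ := mem_iUnion.1 hV
      exact mem_iUnion.2 ⟨⟨(n, V), hn⟩, hy⟩)
  obtain ⟨v, hvc, hvo, hvt⟩ := exists_iUnion_eq_closure_subset hto htlf.point_finite htc
  have hvlf : LocallyFinite v := htlf.subset fun i => subset_closure.trans (hvt i)
  obtain ⟨u, huc, huo, huv⟩ := exists_iUnion_eq_closure_subset hvo hvlf.point_finite hvc
  have hulf : LocallyFinite u := hvlf.subset fun i => subset_closure.trans (huv i)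
  set C : ι → X := fun i => c i.1.1 (z i) with hC
  set R : ι → ℝ := fun i => r i.1.1 (z i) with hR
  have hRpos : ∀ i, 0 < R i := fun i => (hS _).pos _
  have hRle : ∀ i, R i ≤ ε := fun i => (hS _).le _
  let O : ι → Set X := fun i => f ⁻¹' (u i) ∩ ball (C i) (R i / 2) ∩
    (⋃ j : {j : ι // i.1.1 < j.1.1}, f ⁻¹' (closure (v j)) ∩ closedBall (C j) (R j))ᶜ
  let G : ι → Set X := fun i => f ⁻¹' (closure (u i)) ∩ closedBall (C i) (R i / 2) ∩
    (⋃ j : {j : ι // i.1.1 < j.1.1}, f ⁻¹' (v j) ∩ ball (C j) (R j))ᶜ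
  have hOo : ∀ i, IsOpen (O i) := by
    intro i
    refine (((huo i).preimage hf).inter isOpen_ball).inter (isOpen_compl_iff.2 ?_)
    refine LocallyFinite.isClosed_iUnion ?_
      (fun j => (isClosed_closure.preimage hf).inter isClosed_closedBall)
    exact ((hvlf.closure.preimage_continuous hf).comp_injective
      Subtype.val_injective).subset (fun j => inter_subset_left)
  have hGc : ∀ i, IsClosed (G i) := by
    intro i
    refine ((isClosed_closure.preimage hf).inter isClosed_closedBall).inter
      (isClosed_compl_iff.2 ?_)
    exact isOpen_iUnion fun j => ((hvo _).preimage hf).inter isOpen_ball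
  have hOG : ∀ i, O i ⊆ G i := by
    intro i
    refine inter_subset_inter (inter_subset_inter (preimage_mono subset_closure)
      ball_subset_closedBall) (compl_subset_compl.2 (iUnion_mono fun j => ?_))
    exact inter_subset_inter (preimage_mono subset_closure) ball_subset_closedBall
  have hGclosed : IsClosed (⋃ i, G i) := by
    refine LocallyFinite.isClosed_iUnion ?_ hGc
    exact (hulf.closure.preimage_continuous hf).subset
      (fun j => inter_subset_left.trans inter_subset_left)
  have hcl : closure (⋃ i, O i) ⊆ ⋃ i, G i := closure_minimal (iUnion_mono hOG) hGclosed
  have hGdisj' : ∀ i j, i.1.1 < j.1.1 → Disjoint (G i) (G j) := by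
    intro i j hij
    rw [disjoint_left]
    intro x hi hj
    refine hi.2 (mem_iUnion.2 ⟨⟨j, hij⟩, huv j hj.1.1, ?_⟩)
    have h1 : dist x (C j) ≤ R j / 2 := hj.1.2
    have h2 := hRpos j
    rw [mem_ball]
    change dist x (C j) < R j
    linarith
  have hGdisj : ∀ i j, i ≠ j → Disjoint (G i) (G j) := by
    intro i j hij
    rcases lt_trichotomy i.1.1 j.1.1 with h | h | h
    · exact hGdisj' i j h
    · rw [disjoint_left]
      intro x hi hj
      exact hij (hdisj i j h ⟨f x, htV i (hvt i (subset_closure (huv i hi.1.1))),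
        htV j (hvt j (subset_closure (huv j hj.1.1)))⟩)
    · exact (hGdisj' j i h).symm
  refine ⟨⋃ i, O i, isOpen_iUnion hOo, ?_, ?_, ?_⟩
  · refine eq_univ_of_forall fun y => ?_
    obtain ⟨i, hi⟩ := mem_iUnion.1 (huc.ge (mem_univ y))
    have key : ∀ m, ∃ p ∈ 𝒢 (i.1.1 + 1 + m), y ∈ p.1 ∧ p.2 ⊆ ball (C i) (R i / 2) ∧
        ∀ j : ι, i.1.1 < j.1.1 → j.1.1 < i.1.1 + 1 + m → y ∈ closure (v j) →
          Disjoint p.2 (closedBall (C j) (R j)) := by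
      intro m
      induction m with
      | zero =>
        refine ⟨(closure (w i.1.1 (z i)), ball (C i) (R i / 2)), ?_, ?_, subset_rfl, ?_⟩
        · rw [add_zero, hstep]
          exact Or.inr ⟨z i, rfl⟩
        · exact subset_closure (hz i (htV i (hvt i (subset_closure (huv i (subset_closure hi))))))
        · intro j h1 h2; omega
      | succ m ih =>
        obtain ⟨p, hp, hyp, hpb, hpj⟩ := ih
        by_cases hj : ∃ j : ι, j.1.1 = i.1.1 + 1 + m ∧ y ∈ closure (v j)
        · obtain ⟨j, hj, hyj⟩ := hj
          refine ⟨(p.1 ∩ closure (w j.1.1 (z j)), p.2 \ closedBall (C j) (R j)), ?_,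
            ⟨hyp, subset_closure (hz j (htV j (hvt j hyj)))⟩, sdiff_subset.trans hpb, ?_⟩
          · rw [← add_assoc, hstep, ← hj]
            rw [← hj] at hp
            exact Or.inl (Or.inr ⟨p, hp, z j, rfl⟩)
          · intro k hk1 hk2 hyk
            by_cases hk : k.1.1 = i.1.1 + 1 + m
            · have : k = j := hdisj k j (hk.trans hj.symm)
                ⟨y, htV k (hvt k hyk), htV j (hvt j hyj)⟩
              subst this
              exact disjoint_sdiff_left
            · exact (hpj k hk1 (by omega) hyk).mono_left sdiff_subset
        · refine ⟨p, ?_, hyp, hpb, ?_⟩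
          · rw [← add_assoc, hstep]
            exact Or.inl (Or.inl hp)
          · intro k hk1 hk2 hyk
            by_cases hk : k.1.1 = i.1.1 + 1 + m
            · exact absurd ⟨k, hk, hyk⟩ hj
            · exact hpj k hk1 (by omega) hyk
    have hfin : {j : ι | y ∈ closure (v j)}.Finite := hvlf.closure.point_finite y
    obtain ⟨M, hM⟩ := (hfin.image (fun j : ι => j.1.1)).bddAbove
    obtain ⟨p, hp, hyp, hpb, hpj⟩ := key M
    obtain ⟨x, hxp, hxy⟩ := ((h𝒢 _).1 p hp).2.2 hyp
    refine ⟨x, mem_iUnion.2 ⟨i, ⟨?_, hpb hxp⟩, ?_⟩, hxy⟩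
    · rw [mem_preimage, hxy]; exact hi
    · intro hx
      obtain ⟨⟨j, hij⟩, hj1, hj2⟩ := mem_iUnion.1 hx
      rw [mem_preimage, hxy] at hj1
      have : j.1.1 ≤ M := hM ⟨j, hj1, rfl⟩
      exact disjoint_left.1 (hpj j hij (by omega) hj1) hxp hj2
  · refine hcl.trans (iUnion_subset fun i => ?_)
    intro x hx
    refine (hS i.1.1).sub (z i) (closedBall_subset_closedBall ?_ hx.1.2)
    have := hRpos i
    change R i / 2 ≤ R i
    linarith
  · intro y
    refine FinPart.mono (S := (⋃ i, G i) ∩ f ⁻¹' {y}) ?_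
      (isClosed_closure.inter (isClosed_singleton.preimage hf))
      (inter_subset_inter_left _ hcl)
    have hfin : {j : ι | y ∈ closure (u j)}.Finite := hulf.closure.point_finite y
    refine ⟨(fun i => G i ∩ f ⁻¹' {y}) '' {j : ι | y ∈ closure (u j)}, hfin.image _, ?_, ?_, ?_⟩
    · rintro _ ⟨i, hi, rfl⟩
      refine ⟨(hGc i).inter (isClosed_singleton.preimage hf), ?_⟩
      intro a ha b hb
      have h1 : dist a (C i) ≤ R i / 2 := ha.1.1.2
      have h2 : dist b (C i) ≤ R i / 2 := hb.1.1.2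
      have := dist_triangle_right a b (C i)
      linarith [hRle i]
    · rintro _ ⟨i, hi, rfl⟩ _ ⟨j, hj, rfl⟩ hne
      have : i ≠ j := by rintro rfl; exact hne rfl
      exact (hGdisj i j this).mono inter_subset_left inter_subset_left
    · ext x
      simp only [sUnion_image, mem_iUnion, mem_inter_iff, exists_prop]
      constructor
      · rintro ⟨i, _, h1, h2⟩; exact ⟨⟨i, h1⟩, h2⟩
      · rintro ⟨⟨i, h1⟩, h2⟩
        refine ⟨i, ?_, h1, h2⟩
        have h3 : f x ∈ closure (u i) := h1.1.1
        have h4 : f x = y := h2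
        rw [h4] at h3
        exact h3

theorem exists_light {X Y : Type*} [MetricSpace X] [TopologicalSpace Y] [T2Space Y]
    [ParacompactSpace Y] (hY : IsCSpace Y) {f : X → Y} (hf : Continuous f) (hopen : IsOpenMap f)
    (hdense : ∀ y : Y, ∀ x ∈ f ⁻¹' {y}, AccPt x (𝓟 (f ⁻¹' {y})))
    (hcompl : ∀ y : Y, IsComplete (f ⁻¹' {y}))
    {U : Set X} (hU : IsOpen U) (hUY : f '' U = univ) :
    ∃ H : Set X, IsClosed H ∧ H ⊆ U ∧ f '' H = univ ∧
      ∀ y, IsCompact (H ∩ f ⁻¹' {y}) ∧ ∀ ε > 0, FinPart ε (H ∩ f ⁻¹' {y}) := by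
  choose T hTo hTY hTc hTP using fun (U : {U : Set X // IsOpen U ∧ f '' U = univ}) (n : ℕ) =>
    shrink_open hY hf hopen hdense U.2.1 U.2.2 (ε := 1 / ((n : ℝ) + 1)) (by positivity)
  let A : ℕ → {U : Set X // IsOpen U ∧ f '' U = univ} := fun n =>
    Nat.rec ⟨U, hU, hUY⟩ (fun n V => ⟨T V n, hTo V n, hTY V n⟩) n
  have hAc : ∀ n, closure (A (n + 1)).1 ⊆ (A n).1 := fun n => hTc (A n) n
  have hAP : ∀ (n : ℕ) (y : Y), FinPart (1 / ((n : ℝ) + 1)) (closure (A (n + 1)).1 ∩ f ⁻¹' {y}) :=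
    fun n y => hTP (A n) n y
  let S : Y → ℕ → Set X := fun y n => closure (A (n + 1)).1 ∩ f ⁻¹' {y}
  have hSc : ∀ y n, IsClosed (S y n) := fun y n =>
    isClosed_closure.inter (isClosed_singleton.preimage hf)
  have hSZ : ∀ y n, S y n ⊆ f ⁻¹' {y} := fun y n => inter_subset_right
  have hSP : ∀ y, ∀ ε > 0, ∃ n, FinPart ε (S y n) := by
    intro y ε hε
    obtain ⟨n, hn⟩ := exists_nat_one_div_lt hε
    obtain ⟨P, h1, h2, h3, h4⟩ := hAP n y
    exact ⟨n, P, h1, fun B hB => ⟨(h2 B hB).1, fun a ha b hb =>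
      ((h2 B hB).2 a ha b hb).trans hn.le⟩, h3, h4⟩
  have hSanti : ∀ y, Antitone (S y) := fun y => antitone_nat_of_succ_le fun n =>
    inter_subset_inter_left _ ((hAc (n + 1)).trans subset_closure)
  have hSne : ∀ y n, (S y n).Nonempty := by
    intro y n
    obtain ⟨x, hx, hxy⟩ := (A (n + 1)).2.2.ge (mem_univ y)
    exact ⟨x, subset_closure hx, hxy⟩
  have hHS : ∀ y, (⋂ n, closure (A (n + 1)).1) ∩ f ⁻¹' {y} = ⋂ n, S y n := by
    intro y
    exact iInter_inter _ _
  refine ⟨⋂ n, closure (A (n + 1)).1, isClosed_iInter fun n => isClosed_closure,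
    (iInter_subset _ 0).trans (hAc 0), ?_, ?_⟩
  · refine eq_univ_of_forall fun y => ?_
    have : Nonempty X := ⟨(hSne y 0).some⟩
    have hne : (⨅ n, 𝓟 (S y n)).NeBot := by
      refine iInf_neBot_of_directed ?_ (fun n => principal_neBot_iff.2 (hSne y n))
      exact (directed_of_isDirected_le fun m n h => principal_mono.2 (hSanti y h))
    obtain ⟨x, hx, -⟩ := ultra_lim (hcompl y) (S y) (hSc y) (hSZ y) (hSP y)
      (Ultrafilter.of (⨅ n, 𝓟 (S y n))) (fun n => Ultrafilter.of_le _
        (mem_iInf_of_mem n (mem_principal_self _)))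
    rw [← hHS] at hx
    exact ⟨x, hx.1, hx.2⟩
  · intro y
    rw [hHS]
    constructor
    · rw [isCompact_iff_ultrafilter_le_nhds']
      intro F hF
      exact ultra_lim (hcompl y) (S y) (hSc y) (hSZ y) (hSP y) F
        (fun n => mem_of_superset hF (iInter_subset _ n))
    · intro ε hε
      obtain ⟨n, hn⟩ := hSP y ε hε
      exact hn.mono (isClosed_iInter (hSc y)) (iInter_subset _ n)

theorem hyper_nhd {X : Type*} [TopologicalSpace X] {O : Set (Hyper X)} (hO : IsOpen O)
    (S : Hyper X) (hS : S ∈ O) :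
    ∃ (U F : Set X), IsOpen U ∧ F.Finite ∧ S.carrier ⊆ U ∧ F ⊆ S.carrier ∧
      ∀ S' : Hyper X, F ⊆ S'.carrier → S'.carrier ⊆ U → S' ∈ O := by
  induction hO with
  | basic s hs =>
    obtain ⟨𝒱, h𝒱, rfl⟩ := hs
    have : ∀ V : Set X, ∃ x, V ∈ 𝒱 → x ∈ S.carrier ∩ V := by
      intro V
      by_cases h : V ∈ 𝒱
      · obtain ⟨x, hx⟩ := hS.2 V h
        exact ⟨x, fun _ => hx⟩
      · obtain ⟨x, _⟩ := S.nonempty'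
        exact ⟨x, fun h' => absurd h' h⟩
    choose e he using this
    refine ⟨⋃₀ (𝒱 : Set (Set X)), e '' 𝒱, isOpen_sUnion fun V hV => h𝒱 V hV,
      𝒱.finite_toSet.image e, hS.1, ?_, ?_⟩
    · rintro _ ⟨V, hV, rfl⟩
      exact (he V hV).1
    · intro S' h1 h2
      exact ⟨h2, fun V hV => ⟨e V, h1 ⟨V, hV, rfl⟩, (he V hV).2⟩⟩
  | univ => exact ⟨univ, ∅, isOpen_univ, finite_empty, subset_univ _, empty_subset _,
      fun _ _ _ => mem_univ _⟩
  | inter s t _ _ ihs iht =>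
    obtain ⟨U, F, h1, h2, h3, h4, h5⟩ := ihs hS.1
    obtain ⟨U', F', h1', h2', h3', h4', h5'⟩ := iht hS.2
    exact ⟨U ∩ U', F ∪ F', h1.inter h1', h2.union h2', subset_inter h3 h3',
      union_subset h4 h4', fun S' ha hb =>
      ⟨h5 S' (subset_union_left.trans ha) (hb.trans inter_subset_left),
        h5' S' (subset_union_right.trans ha) (hb.trans inter_subset_right)⟩⟩
  | sUnion 𝒮 _ ih =>
    obtain ⟨s, hs, hSs⟩ := hS
    obtain ⟨U, F, h1, h2, h3, h4, h5⟩ := ih s hs hSs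
    exact ⟨U, F, h1, h2, h3, h4, fun S' ha hb => ⟨s, hs, h5 S' ha hb⟩⟩

theorem statement14 {X Y : Type*} [MetricSpace X]
    [TopologicalSpace Y] [T2Space Y] [ParacompactSpace Y] (hY : IsCSpace Y)
    (f : X → Y) (hf : Continuous f) (hopen : IsOpenMap f) (hsurj : Function.Surjective f)
    (hdense : ∀ y : Y, ∀ x ∈ f ⁻¹' {y}, AccPt x (𝓟 (f ⁻¹' {y})))
    (hcompl : ∀ y : Y, IsComplete (f ⁻¹' {y})) :
    Dense {H : ↥{S : Hyper X | f '' S.carrier = Set.univ} |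
      ∀ y : Y, IsCompact {x ∈ (H : Hyper X).carrier | f x = y} ∧
        CovDimZero ↥{x ∈ (H : Hyper X).carrier | f x = y}} := by
  rw [dense_iff_inter_open]
  rintro O hO ⟨S, hSO⟩
  obtain ⟨O', hO', rfl⟩ := isOpen_induced_iff.1 hO
  obtain ⟨U, F, hU, hF, hSU, hFS, hUF⟩ := hyper_nhd hO' S.1 hSO
  have hSY : f '' S.1.carrier = univ := S.2
  have hUY : f '' U = univ := eq_univ_of_univ_subset (hSY.ge.trans (image_mono hSU))
  obtain ⟨H, hHc, hHU, hHY, hH⟩ := exists_light hY hf hopen hdense hcompl hU hUY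
  have hne : H.Nonempty := by
    obtain ⟨x, _⟩ := S.1.nonempty'
    obtain ⟨a, ha, _⟩ := hHY.ge (mem_univ (f x))
    exact ⟨a, ha⟩
  let T : Hyper X := ⟨F ∪ H, hF.isClosed.union hHc, hne.mono subset_union_right⟩
  have hTY : f '' T.carrier = univ :=
    eq_univ_of_univ_subset (hHY.ge.trans (image_mono subset_union_right))
  refine ⟨⟨T, hTY⟩, hUF T subset_union_left (union_subset (hFS.trans hSU) hHU), ?_⟩
  intro y
  have hFy : (F ∩ f ⁻¹' {y}).Finite := hF.subset inter_subset_left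
  have hT : {x ∈ T.carrier | f x = y} = (F ∩ f ⁻¹' {y}) ∪ (H ∩ f ⁻¹' {y}) := by
    rw [← union_inter_distrib_right]; rfl
  have hK : IsCompact {x ∈ T.carrier | f x = y} := by
    rw [hT]; exact hFy.isCompact.union (hH y).1
  refine ⟨hK, covDimZero_of_finPart hK fun ε hε => ?_⟩
  rw [hT]
  exact ((hH y).2 ε hε).union hε.le hFy
end

section
/- Let Y be a metrizable space and 𝔠 the Cantor space 2^ω. Then there exists a closed zero-dimensional subset A ⊂ Y × 𝔠 such that P_Y(A) = Y, where P_Y : Y × 𝔠 → Y is the projection. -/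
open Set Topology Filter

theorem covDimZero_of_labels {Z T : Type*} [TopologicalSpace Z] (ψ : ℕ → Z → T)
    (hloc : ∀ k a, ∀ᶠ b in 𝓝 a, ψ k b = ψ k a)
    (hsmall : ∀ a, ∀ U : Set Z, IsOpen U → a ∈ U →
      ∃ k, ∀ b, (∀ j < k, ψ j b = ψ j a) → b ∈ U) : CovDimZero Z := by
  classical
  intro 𝒰 hopen hcov
  let cell : Z → ℕ → Set Z := fun a k => {b | ∀ j < k, ψ j b = ψ j a}
  have hex : ∀ a, ∃ k, ∃ U ∈ 𝒰, cell a k ⊆ U := by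
    intro a
    have ha : a ∈ ⋃₀ (𝒰 : Set (Set Z)) := by rw [hcov]; trivial
    obtain ⟨U, hU, haU⟩ := ha
    obtain ⟨k, hk⟩ := hsmall a U (hopen U hU) haU
    exact ⟨k, U, hU, fun b hb => hk b hb⟩
  let K : Z → ℕ := fun a => Nat.find (hex a)
  have hK : ∀ a, ∃ U ∈ 𝒰, cell a (K a) ⊆ U := fun a => Nat.find_spec (hex a)
  let C : Z → Set Z := fun a => cell a (K a)
  let F : Set Z → Set Z := fun S => if h : ∃ U ∈ 𝒰, S ⊆ U then h.choose else ∅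
  have hF : ∀ a, F (C a) ∈ 𝒰 ∧ C a ⊆ F (C a) := by
    intro a
    have h : ∃ U ∈ 𝒰, C a ⊆ U := hK a
    simp only [F, dif_pos h]
    exact h.choose_spec
  have hself : ∀ a, a ∈ C a := fun a j _ => rfl
  have hcell : ∀ a b k, (∀ j < k, ψ j b = ψ j a) → cell b k = cell a k := by
    intro a b k h
    ext x
    exact ⟨fun hx j hj => (hx j hj).trans (h j hj), fun hx j hj => (hx j hj).trans (h j hj).symm⟩
  have hCloc : ∀ a, ∀ᶠ b in 𝓝 a, C b = C a := by
    intro a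
    have h1 : ∀ᶠ b in 𝓝 a, ∀ j ∈ Finset.range (K a), ψ j b = ψ j a :=
      (Filter.eventually_all_finset _).2 fun j _ => hloc j a
    filter_upwards [h1] with b hb
    have hb' : ∀ j < K a, ψ j b = ψ j a := fun j hj => hb j (Finset.mem_range.2 hj)
    have hKb : K b = K a := by
      refine (Nat.find_eq_iff (hex b)).2 ⟨?_, ?_⟩
      · rw [hcell a b (K a) hb']; exact hK a
      · intro n hn
        rw [hcell a b n fun j hj => hb' j (hj.trans hn)]
        exact Nat.find_min (hex a) hn
    change cell b (K b) = cell a (K a)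
    rw [hKb, hcell a b (K a) hb']
  refine ⟨𝒰.image fun U => {a | F (C a) = U}, ?_, ?_, ?_, ?_⟩
  · intro V hV
    obtain ⟨U, hU, rfl⟩ := Finset.mem_image.1 hV
    rw [isOpen_iff_mem_nhds]
    intro a ha
    filter_upwards [hCloc a] with b hb
    change F (C b) = U
    rw [hb]; exact ha
  · intro V hV V' hV' hne
    obtain ⟨U, hU, rfl⟩ := Finset.mem_image.1 hV
    obtain ⟨U', hU', rfl⟩ := Finset.mem_image.1 hV'
    rw [Set.disjoint_left]
    intro a ha ha'
    apply hne
    have : U = U' := ha.symm.trans ha'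
    rw [this]
  · intro V hV
    obtain ⟨U, hU, rfl⟩ := Finset.mem_image.1 hV
    refine ⟨U, hU, ?_⟩
    rintro a rfl
    exact (hF a).2 (hself a)
  · rw [Set.eq_univ_iff_forall]
    intro a
    exact ⟨{b | F (C b) = F (C a)}, Finset.mem_coe.2 (Finset.mem_image.2 ⟨_, (hF a).1, rfl⟩), rfl⟩

/-- Stone's construction. -/
theorem stone_cover {Y : Type*} [MetricSpace Y] (ε : ℝ) (hε : 0 < ε) :
    ∃ (E : ℕ → Set Y) (φ : ℕ → Y → Y), (∀ n, IsClosed (E n)) ∧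
      (∀ y, ∃ n, y ∈ interior (E n)) ∧
      ∀ n, ∀ y ∈ E n, dist y (φ n y) < ε ∧ ∀ᶠ y' in 𝓝 y, y' ∈ E n → φ n y' = φ n y := by
  classical
  have hex : ∀ z : Y, ∃ p : Y, dist z p < ε ∧ ∀ x, WellOrderingRel x p → ε ≤ dist z x := by
    intro z
    have wf : WellFounded (WellOrderingRel (α := Y)) := IsWellFounded.wf
    obtain ⟨p, hp, hmin⟩ := wf.has_min {x | dist z x < ε} ⟨z, by simpa using hε⟩
    exact ⟨p, hp, fun x hx => not_lt.1 fun h => hmin x h hx⟩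
  choose p hp hpmin using hex
  let r : ℕ → ℝ := fun n => 1 / ((n : ℝ) + 1)
  have hr : ∀ n, 0 < r n := fun n => Nat.one_div_pos_of_nat
  let S : ℕ → Set Y := fun n => {z | dist z (p z) + 4 * r n ≤ ε}
  have key0 : ∀ n z z', z ∈ S n → WellOrderingRel (p z) (p z') → 4 * r n ≤ dist z z' := by
    intro n z z' hz h
    have h1 := hpmin z' (p z) h
    have h2 := dist_triangle z' z (p z)
    have h3 : dist z (p z) + 4 * r n ≤ ε := hz
    rw [dist_comm z' z] at h2
    linarith
  have key : ∀ n z z', z ∈ S n → z' ∈ S n → dist z z' < 4 * r n → p z = p z' := by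
    intro n z z' hz hz' h
    rcases trichotomous_of WellOrderingRel (p z) (p z') with h1 | h1 | h1
    · exact absurd (key0 n z z' hz h1) (not_le.2 h)
    · exact h1
    · have := key0 n z' z hz' h1
      rw [dist_comm] at this
      exact absurd this (not_le.2 h)
  let E : ℕ → Set Y := fun n => closure (⋃ z ∈ S n, Metric.ball z (r n))
  have hE : ∀ n y, y ∈ E n → ∃ z ∈ S n, dist y z < 2 * r n := by
    intro n y hy
    obtain ⟨w, hw, hyw⟩ := Metric.mem_closure_iff.1 hy (r n) (hr n)
    simp only [Set.mem_iUnion, Metric.mem_ball] at hw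
    obtain ⟨z, hz, hwz⟩ := hw
    refine ⟨z, hz, ?_⟩
    linarith [dist_triangle y w z]
  choose! q hqS hqd using hE
  refine ⟨E, fun n y => p (q n y), fun n => isClosed_closure, ?_, ?_⟩
  · intro y
    have hpos : 0 < (ε - dist y (p y)) / 4 := by linarith [hp y]
    obtain ⟨n, hn⟩ := exists_nat_one_div_lt hpos
    refine ⟨n, ?_⟩
    have hsub : Metric.ball y (r n) ⊆ E n := by
      refine subset_trans ?_ subset_closure
      have hy : y ∈ S n := by
        change dist y (p y) + 4 * (1 / ((n : ℝ) + 1)) ≤ ε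
        linarith
      exact Set.subset_biUnion_of_mem (u := fun z => Metric.ball z (r n)) hy
    exact interior_maximal hsub Metric.isOpen_ball (Metric.mem_ball_self (hr n))
  · intro n y hy
    have h1 : dist (q n y) (p (q n y)) + 4 * r n ≤ ε := hqS n y hy
    have h2 := hqd n y hy
    refine ⟨?_, ?_⟩
    · linarith [dist_triangle y (q n y) (p (q n y)), hr n]
    · have : Metric.ball (q n y) (2 * r n) ∈ 𝓝 y := Metric.isOpen_ball.mem_nhds h2
      filter_upwards [this] with y' hy' hy'E
      refine key n _ _ (hqS n y' hy'E) (hqS n y hy) ?_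
      have h3 := hqd n y' hy'E
      have h4 : dist y' (q n y) < 2 * r n := hy'
      have h5 := dist_triangle (q n y') y' (q n y)
      rw [dist_comm (q n y') y'] at h5
      linarith

theorem coord_eventually (c : ℕ → Bool) (i : ℕ) : ∀ᶠ c' in 𝓝 c, c' i = c i := by
  have h : Tendsto (fun c' : ℕ → Bool => c' i) (𝓝 c) (𝓝 (c i)) := (continuous_apply i).tendsto c
  exact h (by simp : ({c i} : Set Bool) ∈ 𝓝 (c i))

theorem statement15 {Y : Type*} [TopologicalSpace Y] [TopologicalSpace.MetrizableSpace Y] :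
    ∃ A : Set (Y × (ℕ → Bool)), IsClosed A ∧ CovDimZero ↥A ∧
      Prod.fst '' A = Set.univ := by
  classical
  letI : MetricSpace Y := TopologicalSpace.metrizableSpaceMetric Y
  have H := fun k : ℕ => stone_cover (Y := Y) (1 / ((k : ℝ) + 1)) Nat.one_div_pos_of_nat
  choose E φ hEc hEi hφ using H
  let D : ℕ → Set Y := fun i => E i.unpair.1 i.unpair.2
  have hD : ∀ i, IsClosed (D i) := fun i => hEc _ _
  let A : Set (Y × (ℕ → Bool)) :=
    {a | ∀ i, (a.2 i = true → a.1 ∈ D i) ∧ (a.2 i = false → a.1 ∉ interior (D i))}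
  have hcoord : ∀ (i : ℕ) (b : Bool), IsOpen {a : Y × (ℕ → Bool) | a.2 i = b} := by
    intro i b
    have hcont : Continuous fun a : Y × (ℕ → Bool) => a.2 i := by fun_prop
    exact (isOpen_discrete ({b} : Set Bool)).preimage hcont
  have hA : IsClosed A := by
    have : A = ⋂ i, ({a | a.2 i = true → a.1 ∈ D i} ∩
        {a | a.2 i = false → a.1 ∉ interior (D i)}) := by
      ext a; simp [A, Set.mem_iInter]
    rw [this]
    refine isClosed_iInter fun i => IsClosed.inter ?_ ?_
    · exact isClosed_imp (hcoord i true) ((hD i).preimage continuous_fst)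
    · exact isClosed_imp (hcoord i false) (isOpen_interior.isClosed_compl.preimage continuous_fst)
  refine ⟨A, hA, ?_, ?_⟩
  · have hn : ∀ (k : ℕ) (a : A), ∃ n, a.1.2 (Nat.pair k n) = true := by
      intro k a
      obtain ⟨n, hn⟩ := hEi k a.1.1
      refine ⟨n, ?_⟩
      by_contra h
      have h' := (a.2 (Nat.pair k n)).2 (by simpa using h)
      simp only [D, Nat.unpair_pair] at h'
      exact h' hn
    let N : ℕ → A → ℕ := fun k a => Nat.find (hn k a)
    have hN : ∀ k a, a.1.1 ∈ E k (N k a) := by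
      intro k a
      have h' := (a.2 (Nat.pair k (N k a))).1 (Nat.find_spec (hn k a))
      simpa only [D, Nat.unpair_pair] using h'
    have hc : ∀ (i : ℕ) (a : A), ∀ᶠ b in 𝓝 a, b.1.2 i = a.1.2 i := by
      intro i a
      have : Tendsto (fun b : A => b.1.2) (𝓝 a) (𝓝 a.1.2) :=
        (continuous_snd.comp continuous_subtype_val).tendsto a
      exact this.eventually (coord_eventually a.1.2 i)
    have hNloc : ∀ k a, ∀ᶠ b in 𝓝 a, N k b = N k a := by
      intro k a
      have h1 : ∀ᶠ b in 𝓝 a, ∀ j ∈ Finset.range (N k a + 1),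
          b.1.2 (Nat.pair k j) = a.1.2 (Nat.pair k j) :=
        (Filter.eventually_all_finset _).2 fun j _ => hc _ a
      filter_upwards [h1] with b hb
      refine (Nat.find_eq_iff (hn k b)).2 ⟨?_, ?_⟩
      · rw [hb _ (by simp)]; exact Nat.find_spec (hn k a)
      · intro n hlt
        rw [hb _ (by simp; omega)]
        exact Nat.find_min (hn k a) hlt
    refine covDimZero_of_labels (fun k (a : A) => (φ k (N k a) a.1.1, a.1.2 k)) ?_ ?_
    · intro k a
      have hfst : Tendsto (fun b : A => b.1.1) (𝓝 a) (𝓝 a.1.1) :=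
        (continuous_fst.comp continuous_subtype_val).tendsto a
      filter_upwards [hNloc k a, hc k a,
        hfst.eventually (hφ k (N k a) a.1.1 (hN k a)).2] with b h1 h2 h3
      have h4 := hN k b
      rw [h1] at h4
      simp only [h1, h2, h3 h4]
    · intro a U hU haU
      obtain ⟨O, hO, rfl⟩ := isOpen_induced_iff.1 hU
      obtain ⟨P, Q, hP, hQ, haP, haQ, hPQ⟩ := isOpen_prod_iff.1 hO a.1.1 a.1.2 haU
      obtain ⟨ε, hε, hball⟩ := Metric.isOpen_iff.1 hP a.1.1 haP
      obtain ⟨k, hk⟩ := exists_nat_one_div_lt (half_pos hε)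
      obtain ⟨I, u, hu, hIu⟩ := isOpen_pi_iff.1 hQ a.1.2 haQ
      refine ⟨max (k + 1) (I.sup id + 1), fun b hb => hPQ ⟨hball ?_, hIu ?_⟩⟩
      · have h1 := hb k (by simp)
        have h2 : φ k (N k b) b.1.1 = φ k (N k a) a.1.1 := congrArg Prod.fst h1
        have h3 := (hφ k (N k a) a.1.1 (hN k a)).1
        have h4 := (hφ k (N k b) b.1.1 (hN k b)).1
        rw [h2] at h4
        rw [Metric.mem_ball]
        have := dist_triangle_right b.1.1 a.1.1 (φ k (N k a) a.1.1)
        linarith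
      · intro i hi
        have hi' : i ≤ I.sup id := Finset.le_sup (f := id) hi
        have h1 := hb i (by omega)
        have h2 : b.1.2 i = a.1.2 i := congrArg Prod.snd h1
        rw [h2]; exact (hu i hi).2
  · rw [Set.eq_univ_iff_forall]
    intro y
    refine ⟨(y, fun i => decide (y ∈ D i)), fun i => ⟨?_, ?_⟩, rfl⟩
    · intro h; exact of_decide_eq_true h
    · intro h h'; exact of_decide_eq_false h (interior_subset h')
end
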